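/- arXiv:2202.00933 — 3 statements merged into one kernel-verified Lean document; each statement's English description precedes it below -/
import Mathlib

section
/- Decay of the inverse covariance (Theorem 2.1, bound (2.1)). Fix constants K < ∞, κ > 1 and 0 < λ_inf ≤ λ_sup < ∞. Then there exists a constant 𝒦 < ∞, depending only on K, κ, λ_inf, λ_sup (in particular not on p), such that for every p ∈ ℕ and every operator 𝐂 satisfying Assumption A(p, K, κ, λ_inf, λ_sup), the inverse 𝐃 = 𝐂⁻¹ exists as a bounded operator on H_p and its blocks satisfy ‖D_{t,τ}‖₂ ≤ 𝒦 ζ(t−τ)^{κ−1} for all t, τ ∈ ℤ. -/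
noncomputable section

/-- `⟨x⟩ = max(1,|x|)` -/
def gu (x : ℝ) : ℝ := max 1 |x|

/-- `ζ(x) = max(1, log⟨x⟩)/⟨x⟩` -/
def zeta (x : ℝ) : ℝ := max 1 (Real.log (gu x)) / gu x

/-- spectral norm of a matrix -/
def specNorm {𝕜 : Type*} [RCLike 𝕜] {m n : Type*} [Fintype m] [Fintype n] [DecidableEq n]
    (M : Matrix m n 𝕜) : ℝ :=
  ‖LinearMap.toContinuousLinearMap (Matrix.toEuclideanLin M)‖

/-- `ℓ²(ι; ℝ^p)` -/
abbrev HpI (ι : Type) (p : ℕ) : Type := lp (fun _ : ι => EuclideanSpace ℝ (Fin p)) 2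

abbrev Hp (p : ℕ) : Type := HpI ℤ p

/-- the sequence `δ_t ⊗ e_a` -/
def bvec {ι : Type} [DecidableEq ι] (p : ℕ) (t : ι) (a : Fin p) : HpI ι p :=
  lp.single 2 t (EuclideanSpace.single a 1)

/-- the `p × p` block `A_{t,τ}` of an operator -/
def blk {ι : Type} [DecidableEq ι] {p : ℕ} (A : HpI ι p →L[ℝ] HpI ι p) (t τ : ι) :
    Matrix (Fin p) (Fin p) ℝ :=
  Matrix.of fun a b => inner (𝕜 := ℝ) (bvec p t a) (A (bvec p τ b))

/-- Assumption A(p, K, κ, λ_inf, λ_sup): a bounded self-adjoint operator on `H_p` whose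
quadratic form is bounded between `λ_inf` and `λ_sup` and whose off-diagonal blocks decay
at the rate `K⟨t−τ⟩^{−κ}`. -/
structure AssumptionA (p : ℕ) (K κ lamInf lamSup : ℝ) (C : Hp p →L[ℝ] Hp p) : Prop where
  symm : ∀ x y : Hp p, inner (𝕜 := ℝ) (C x) y = inner (𝕜 := ℝ) x (C y)
  lower : ∀ v : Hp p, lamInf * ‖v‖ ^ 2 ≤ inner (𝕜 := ℝ) v (C v)
  upper : ∀ v : Hp p, inner (𝕜 := ℝ) v (C v) ≤ lamSup * ‖v‖ ^ 2
  decay : ∀ t τ : ℤ, t ≠ τ → specNorm (blk C t τ) ≤ K * gu ((t : ℝ) - (τ : ℝ)) ^ (-κ)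

open scoped ENNReal

section BlockOperators

variable {E : Type*} [NormedAddCommGroup E] [NormedSpace ℝ E]

/-- The block `A_{t,τ}` of an operator on `ℓ²(ℤ; E)`, as an operator on `E`. -/
def blockCLM (A : lp (fun _ : ℤ => E) 2 →L[ℝ] lp (fun _ : ℤ => E) 2) (t τ : ℤ) : E →L[ℝ] E :=
  (lp.evalCLM ℝ (fun _ : ℤ => E) 2 t).comp
    (A.comp (lp.singleContinuousLinearMap ℝ (fun _ : ℤ => E) 2 τ))

theorem blockCLM_apply (A : lp (fun _ : ℤ => E) 2 →L[ℝ] lp (fun _ : ℤ => E) 2) (t τ : ℤ) (v : E) :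
    blockCLM A t τ v = A (lp.single 2 τ v) t := rfl

theorem norm_blockCLM_le (A : lp (fun _ : ℤ => E) 2 →L[ℝ] lp (fun _ : ℤ => E) 2) (t τ : ℤ) :
    ‖blockCLM A t τ‖ ≤ ‖A‖ := by
  refine ContinuousLinearMap.opNorm_le_bound _ (norm_nonneg _) fun v => ?_
  rw [blockCLM_apply]
  refine (lp.norm_apply_le_norm (by norm_num) _ _).trans ((A.le_opNorm _).trans_eq ?_)
  rw [lp.norm_single (by norm_num)]

theorem hasSum_blockCLM (A : lp (fun _ : ℤ => E) 2 →L[ℝ] lp (fun _ : ℤ => E) 2)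
    (x : lp (fun _ : ℤ => E) 2) (t : ℤ) :
    HasSum (fun τ => blockCLM A t τ (x τ)) (A x t) :=
  (lp.hasSum_single (by norm_num) x).mapL ((lp.evalCLM ℝ (fun _ : ℤ => E) 2 t).comp A)

theorem hasSum_blockCLM_sub (A : lp (fun _ : ℤ => E) 2 →L[ℝ] lp (fun _ : ℤ => E) 2)
    (x : lp (fun _ : ℤ => E) 2) (t : ℤ) :
    HasSum (fun j => blockCLM A t (t - j) (x (t - j))) (A x t) :=
  (Equiv.hasSum_iff (f := fun τ => blockCLM A t τ (x τ)) (Equiv.subLeft t)).mpr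
    (hasSum_blockCLM A x t)

theorem exists_weightedShift (j : ℤ) (a : ℤ → E →L[ℝ] E) {M : ℝ} (ha : ∀ t, ‖a t‖ ≤ M) :
    ∃ S : lp (fun _ : ℤ => E) 2 →L[ℝ] lp (fun _ : ℤ => E) 2,
      ‖S‖ ≤ M ∧ ∀ x t, S x t = a t (x (t - j)) := by
  have hM : 0 ≤ M := (norm_nonneg _).trans (ha 0)
  have two : (0 : ℝ) < (2 : ℝ≥0∞).toReal := by norm_num
  have hsq : ∀ x : lp (fun _ : ℤ => E) 2,
      HasSum (fun t => (M * ‖x (t - j)‖) ^ (2 : ℝ≥0∞).toReal) ((M * ‖x‖) ^ (2 : ℝ≥0∞).toReal) := by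
    intro x
    have h := (Equiv.hasSum_iff (Equiv.subRight j)).mpr (lp.hasSum_norm two x)
    have h2 := h.mul_left (M ^ (2 : ℝ≥0∞).toReal)
    rw [← Real.mul_rpow hM (norm_nonneg _)] at h2
    refine HasSum.congr_fun h2 fun t => ?_
    simp [Real.mul_rpow hM (norm_nonneg _)]
  have hle : ∀ (x : lp (fun _ : ℤ => E) 2) (t : ℤ),
      ‖a t (x (t - j))‖ ^ (2 : ℝ≥0∞).toReal ≤ (M * ‖x (t - j)‖) ^ (2 : ℝ≥0∞).toReal := fun x t =>
    Real.rpow_le_rpow (norm_nonneg _) ((a t).le_of_opNorm_le (ha t) _) two.le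
  have hmem : ∀ x : lp (fun _ : ℤ => E) 2, Memℓp (fun t => a t (x (t - j))) 2 := fun x =>
    memℓp_gen (Summable.of_nonneg_of_le (fun t => by positivity) (hle x) (hsq x).summable)
  let L : lp (fun _ : ℤ => E) 2 →ₗ[ℝ] lp (fun _ : ℤ => E) 2 :=
    { toFun := fun x => ⟨fun t => a t (x (t - j)), hmem x⟩
      map_add' := fun x y => by ext1; funext t; exact map_add (a t) _ _
      map_smul' := fun c x => by ext t; simp }
  refine ⟨L.mkContinuous M fun x => ?_, L.mkContinuous_norm_le hM _, fun x t => rfl⟩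
  refine lp.norm_le_of_tsum_le two (by positivity) ?_
  rw [← (hsq x).tsum_eq]
  exact (lp.memℓp (L x)).summable two |>.tsum_le_tsum (hle x) (hsq x).summable

theorem exists_operator_of_diagonal_bounds [CompleteSpace E] (c : ℤ → ℤ → E →L[ℝ] E) {g : ℤ → ℝ}
    {s : ℝ} (hg : HasSum g s) (hc : ∀ t j, ‖c t j‖ ≤ g j) :
    ∃ T : lp (fun _ : ℤ => E) 2 →L[ℝ] lp (fun _ : ℤ => E) 2,
      ‖T‖ ≤ s ∧ ∀ x t, HasSum (fun j => c t j (x (t - j))) (T x t) := by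
  choose S hS hSx using fun j => exists_weightedShift j (fun t => c t j) (fun t => hc t j)
  have hsum : HasSum S (∑' j, S j) := (Summable.of_norm_bounded hg.summable hS).hasSum
  refine ⟨∑' j, S j, hsum.norm_le_of_bounded hg hS, fun x t => ?_⟩
  have h := (hsum.mapL (ContinuousLinearMap.apply ℝ (lp (fun _ : ℤ => E) 2) x)).mapL
    (lp.evalCLM ℝ (fun _ : ℤ => E) 2 t)
  simp only [← hSx]
  exact h

/-- `(A x)_t` depends only on the entries of `x` at distance at most `r` from `t`. -/
def HasBandwidth (A : lp (fun _ : ℤ => E) 2 →L[ℝ] lp (fun _ : ℤ => E) 2) (r : ℕ) : Prop :=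
  ∀ (x : lp (fun _ : ℤ => E) 2) (t : ℤ), (∀ s, |t - s| ≤ (r : ℤ) → x s = 0) → A x t = 0

namespace HasBandwidth

variable {A B : lp (fun _ : ℤ => E) 2 →L[ℝ] lp (fun _ : ℤ => E) 2} {r s : ℕ}

theorem mono (hA : HasBandwidth A r) (h : r ≤ s) : HasBandwidth A s := fun x t hx =>
  hA x t fun u hu => hx u (hu.trans (by exact_mod_cast h))

theorem one : HasBandwidth (1 : lp (fun _ : ℤ => E) 2 →L[ℝ] lp (fun _ : ℤ => E) 2) r :=
  fun _ t hx => hx t (by simp)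

theorem sub (hA : HasBandwidth A r) (hB : HasBandwidth B r) : HasBandwidth (A - B) r :=
  fun x t hx => by simp [hA x t hx, hB x t hx]

theorem smul (c : ℝ) (hA : HasBandwidth A r) : HasBandwidth (c • A) r :=
  fun x t hx => by simp [hA x t hx]

theorem sum {ι : Type*} (u : Finset ι)
    {F : ι → lp (fun _ : ℤ => E) 2 →L[ℝ] lp (fun _ : ℤ => E) 2}
    (hF : ∀ i ∈ u, HasBandwidth (F i) r) : HasBandwidth (∑ i ∈ u, F i) r := fun x t hx => by
  rw [sum_apply, lp.coeFn_sum, Finset.sum_apply]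
  exact Finset.sum_eq_zero fun i hi => hF i hi x t hx

theorem mul (hA : HasBandwidth A r) (hB : HasBandwidth B s) : HasBandwidth (A * B) (r + s) := by
  intro x t hx
  refine hA _ t fun u hu => hB x u fun v hv => hx v ?_
  push_cast
  exact (abs_sub_le t u v).trans (add_le_add hu hv)

theorem pow (hA : HasBandwidth A r) (n : ℕ) : HasBandwidth (A ^ n) (n * r) := by
  induction n with
  | zero => exact one
  | succ n ih => rw [pow_succ, Nat.succ_mul]; exact ih.mul hA

theorem blockCLM_eq_zero (hA : HasBandwidth A r) {t τ : ℤ} (h : r < |t - τ|) :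
    blockCLM A t τ = 0 := by
  ext1 v
  refine hA (lp.single 2 τ v) t fun s hs => lp.single_apply_ne (E := fun _ : ℤ => E) 2 τ v ?_
  rintro rfl
  exact hs.not_gt h

end HasBandwidth

/-- Subtracting from `C` its far off-diagonal part leaves a banded operator. -/
theorem exists_banded_approximation [CompleteSpace E]
    (C : lp (fun _ : ℤ => E) 2 →L[ℝ] lp (fun _ : ℤ => E) 2) (r : ℕ) {g : ℤ → ℝ} {s : ℝ}
    (hg : HasSum (fun j => if (r : ℤ) < |j| then g j else 0) s)
    (hC : ∀ t τ, t ≠ τ → ‖blockCLM C t τ‖ ≤ g (t - τ)) :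
    ∃ T : lp (fun _ : ℤ => E) 2 →L[ℝ] lp (fun _ : ℤ => E) 2, ‖T‖ ≤ s ∧ HasBandwidth (C - T) r := by
  obtain ⟨T, hT, hTx⟩ := exists_operator_of_diagonal_bounds
    (fun t j => if (r : ℤ) < |j| then blockCLM C t (t - j) else 0) hg (by
      intro t j
      split_ifs with hj
      · have hj0 : j ≠ 0 := by rintro rfl; simp at hj; omega
        simpa using hC t (t - j) (by omega)
      · simp)
  refine ⟨T, hT, fun x t hx => ?_⟩
  have h : C x t = T x t := by
    refine (hasSum_blockCLM_sub C x t).unique ((hTx x t).congr_fun ?_ |> id)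
    intro j
    split_ifs with hj
    · rfl
    · rw [hx (t - j) (by simpa using hj)]; simp
  simp [h]

/-- Truncated Neumann series of a nearby banded operator approximates the inverse. -/
theorem norm_blockCLM_inverse_le {C D : lp (fun _ : ℤ => E) 2 →L[ℝ] lp (fun _ : ℤ => E) 2}
    (hDC : D * C = 1) {T : lp (fun _ : ℤ => E) 2 →L[ℝ] lp (fun _ : ℤ => E) 2} {r : ℕ}
    (hT : HasBandwidth (C - T) r) {μ ε q : ℝ} (hμ : 0 ≤ μ) (hε : ‖T‖ ≤ ε) (hq : q < 1)
    (hB : ‖1 - μ • (C - T)‖ ≤ q) (N : ℕ) {t τ : ℤ} (hN : ((N * r : ℕ) : ℤ) < |t - τ|) :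
    ‖blockCLM D t τ‖ ≤ ‖D‖ * (q ^ (N + 1) + μ * ε / (1 - q)) := by
  set B := 1 - μ • (C - T) with hBdef
  have hq0 : 0 ≤ q := (norm_nonneg _).trans hB
  have hε0 : 0 ≤ ε := (norm_nonneg _).trans hε
  set P := ∑ k ∈ Finset.range (N + 1), B ^ k with hP
  have hpow : ∀ k, ‖B ^ k‖ ≤ q ^ k := by
    intro k
    induction k with
    | zero => simpa using! ContinuousLinearMap.norm_id_le
    | succ k ih =>
      rw [pow_succ, pow_succ]
      exact (norm_mul_le _ _).trans (mul_le_mul ih hB (norm_nonneg _) (by positivity))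
  have hPn : ‖P‖ ≤ 1 / (1 - q) := by
    refine (norm_sum_le_of_le _ fun k _ => hpow k).trans ?_
    rw [le_div_iff₀ (by linarith), geom_sum_mul_neg]
    linarith [pow_nonneg hq0 (N + 1)]
  have hband : HasBandwidth (μ • P) (N * r) := by
    refine (HasBandwidth.sum _ fun k hk => ?_).smul μ
    refine ((HasBandwidth.one.sub (hT.smul μ)).pow k).mono ?_
    exact Nat.mul_le_mul_right r (Nat.lt_succ_iff.mp (Finset.mem_range.mp hk))
  have hgeom : (1 - B) * P = 1 - B ^ (N + 1) := mul_neg_geom_sum B (N + 1)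
  have hCP : C * (μ • P) = 1 - B ^ (N + 1) + μ • (T * P) := by
    rw [← hgeom, hBdef]
    simp only [sub_sub_cancel, smul_mul_assoc, sub_mul, mul_smul_comm, smul_sub]
    abel
  have hD : D = μ • P + D * (B ^ (N + 1) - μ • (T * P)) := by
    have h : μ • P = D * (C * (μ • P)) := by rw [← mul_assoc, hDC, one_mul]
    rw [h, hCP, ← mul_add]
    simp
  have hblk : blockCLM D t τ = blockCLM (D * (B ^ (N + 1) - μ • (T * P))) t τ := by
    have h0 := hband.blockCLM_eq_zero hN
    ext1 v
    have h0v : (μ • P) (lp.single 2 τ v) t = 0 := DFunLike.congr_fun h0 v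
    rw [blockCLM_apply, blockCLM_apply]
    conv_lhs => rw [hD]
    rw [add_apply, lp.coeFn_add, Pi.add_apply, h0v, zero_add]
  rw [hblk]
  refine (norm_blockCLM_le _ _ _).trans ((norm_mul_le _ _).trans ?_)
  gcongr
  refine (norm_sub_le _ _).trans (add_le_add (hpow _) ?_)
  rw [norm_smul, Real.norm_of_nonneg hμ, mul_div_assoc]
  gcongr
  refine (norm_mul_le _ _).trans ?_
  rw [div_eq_mul_one_div]
  gcongr

end BlockOperators

section Coercive

variable {H : Type*} [NormedAddCommGroup H] [InnerProductSpace ℝ H]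

theorem norm_le_of_symmetric_of_inner_bounds {B : H →L[ℝ] H} {ρ : ℝ} (hρ : 0 < ρ)
    (hsymm : ∀ x y, inner ℝ (B x) y = inner ℝ x (B y))
    (hnonneg : ∀ x, 0 ≤ inner ℝ x (B x)) (hle : ∀ x, inner ℝ x (B x) ≤ ρ * ‖x‖ ^ 2) :
    ‖B‖ ≤ ρ := by
  refine ContinuousLinearMap.opNorm_le_bound _ hρ.le fun x => ?_
  have h1 := hnonneg (ρ • x - B x)
  have h2 := hle (B x)
  have h3 := hle x
  have h4 : inner ℝ x (B (B x)) = ‖B x‖ ^ 2 := by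
    rw [← hsymm, real_inner_self_eq_norm_sq]
  simp only [map_sub, map_smul, inner_sub_left, inner_sub_right, real_inner_smul_left,
    real_inner_smul_right, h4, real_inner_self_eq_norm_sq] at h1
  have h6 := mul_le_mul_of_nonneg_left h3 (mul_pos hρ hρ).le
  have h5 : ρ * ‖B x‖ ^ 2 ≤ ρ * (ρ * ‖x‖) ^ 2 := by nlinarith
  exact abs_le_of_sq_le_sq' (le_of_mul_le_mul_left h5 hρ) (by positivity) |>.2

theorem norm_le_inv_of_coercive {C D : H →L[ℝ] H} {m : ℝ} (hm : 0 < m)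
    (hlower : ∀ v, m * ‖v‖ ^ 2 ≤ inner ℝ v (C v)) (hCD : C * D = 1) : ‖D‖ ≤ m⁻¹ := by
  refine ContinuousLinearMap.opNorm_le_bound _ (by positivity) fun x => ?_
  have h1 := hlower (D x)
  have h2 : C (D x) = x := DFunLike.congr_fun hCD x
  rw [h2] at h1
  have h3 := h1.trans (real_inner_le_norm (D x) x)
  rw [inv_mul_eq_div, le_div_iff₀ hm]
  rcases (norm_nonneg (D x)).eq_or_lt with h | h
  · rw [← h]; simp
  · refine le_of_mul_le_mul_left ?_ h
    linarith [h3]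

end Coercive

section Tails

theorem rpow_neg_add_one_le_sub {a y : ℝ} (ha : 0 < a) (hy : 0 < y) :
    a * (y + 1) ^ (-(a + 1)) ≤ y ^ (-a) - (y + 1) ^ (-a) := by
  have hy1 : 0 < y + 1 := by linarith
  have hlog : Real.log (y / (y + 1)) ≤ -(1 / (y + 1)) := by
    refine (Real.log_le_sub_one_of_pos (by positivity)).trans_eq ?_
    field_simp
    ring
  have hexp : 1 + a / (y + 1) ≤ (y / (y + 1)) ^ (-a) := by
    rw [Real.rpow_def_of_pos (by positivity)]
    refine le_trans ?_ (Real.add_one_le_exp _)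
    have : a * (1 / (y + 1)) ≤ a * -Real.log (y / (y + 1)) := by gcongr; linarith
    rw [mul_one_div] at this
    linarith
  have h1 : y ^ (-a) = (y / (y + 1)) ^ (-a) * (y + 1) ^ (-a) := by
    rw [← Real.mul_rpow (by positivity) hy1.le, div_mul_cancel₀ _ hy1.ne']
  have h2 : (y + 1) ^ (-(a + 1)) = (y + 1) ^ (-a) / (y + 1) := by
    rw [neg_add', Real.rpow_sub_one hy1.ne']
  have hp : 0 < (y + 1) ^ (-a) := Real.rpow_pos_of_pos hy1 _
  have h3 := mul_le_mul_of_nonneg_right hexp hp.le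
  rw [h1, h2]
  have h4 : a * ((y + 1) ^ (-a) / (y + 1)) = a / (y + 1) * (y + 1) ^ (-a) := by ring
  linarith

theorem sum_range_tail_rpow_le {a : ℝ} (ha : 0 < a) {r : ℕ} (hr : 1 ≤ r) (N : ℕ) :
    ∑ k ∈ Finset.range N, (if r < k then (k : ℝ) ^ (-(a + 1)) else 0) ≤ (r : ℝ) ^ (-a) / a := by
  have hr0 : (0 : ℝ) < r := by exact_mod_cast hr
  have key : ∀ n : ℕ, ∑ k ∈ Finset.range (r + 1 + n),
      (if r < k then (k : ℝ) ^ (-(a + 1)) else 0)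
        ≤ ((r : ℝ) ^ (-a) - ((r + n : ℕ) : ℝ) ^ (-a)) / a := by
    intro n
    induction n with
    | zero =>
      rw [Finset.sum_eq_zero]
      · simp
      · intro k hk
        rw [if_neg]
        simp at hk; omega
    | succ n ih =>
      rw [← add_assoc, Finset.sum_range_succ, if_pos (by omega)]
      have h := rpow_neg_add_one_le_sub (y := ((r + n : ℕ) : ℝ)) ha (by positivity)
      have e : ((r + 1 + n : ℕ) : ℝ) = ((r + n : ℕ) : ℝ) + 1 := by push_cast; ring
      have e' : ((r + (n + 1) : ℕ) : ℝ) = ((r + n : ℕ) : ℝ) + 1 := by push_cast; ring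
      rw [e, e']
      rw [le_div_iff₀ ha] at ih ⊢
      rw [add_mul]
      linarith
  have hmono : ∑ k ∈ Finset.range N, (if r < k then (k : ℝ) ^ (-(a + 1)) else 0)
      ≤ ∑ k ∈ Finset.range (r + 1 + N), (if r < k then (k : ℝ) ^ (-(a + 1)) else 0) := by
    refine Finset.sum_le_sum_of_subset_of_nonneg
      (Finset.range_mono (by omega)) fun k _ _ => ?_
    split_ifs <;> positivity
  refine hmono.trans ((key N).trans ?_)
  gcongr
  have : 0 ≤ ((r + N : ℕ) : ℝ) ^ (-a) := by positivity
  linarith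

theorem exists_hasSum_int_tail_rpow {a : ℝ} (ha : 0 < a) {r : ℕ} (hr : 1 ≤ r) :
    ∃ s ≤ 2 / a * (r : ℝ) ^ (-a),
      HasSum (fun j : ℤ => if (r : ℤ) < |j| then gu j ^ (-(a + 1)) else 0) s := by
  have hnonneg : ∀ k : ℕ, 0 ≤ (if r < k then (k : ℝ) ^ (-(a + 1)) else 0) := fun k => by
    split_ifs <;> positivity
  have hS := (summable_of_sum_range_le hnonneg (sum_range_tail_rpow_le ha hr)).hasSum
  have hle := Real.tsum_le_of_sum_range_le hnonneg (sum_range_tail_rpow_le ha hr)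
  set S := ∑' k : ℕ, (if r < k then (k : ℝ) ^ (-(a + 1)) else 0)
  have hgu : ∀ k : ℕ, r < k → gu (k : ℝ) = k := fun k hk => by
    have : (1 : ℝ) ≤ k := by exact_mod_cast (by omega : 1 ≤ k)
    simp [gu, this]
  have hpos : HasSum (fun k : ℕ => if (r : ℤ) < |(k : ℤ)| then gu ((k : ℤ) : ℝ) ^ (-(a + 1)) else 0)
      S := by
    convert hS using 2 with k
    simp only [Nat.abs_cast, Nat.cast_lt, Int.cast_natCast]
    split_ifs with h
    · rw [hgu k h]
    · rfl
  have hneg : HasSum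
      (fun k : ℕ => if (r : ℤ) < |(-(k : ℤ))| then gu ((-(k : ℤ) : ℤ) : ℝ) ^ (-(a + 1)) else 0)
      S := by
    convert hpos using 2 with k
    simp [gu]
  refine ⟨_, ?_, HasSum.of_nat_of_neg (f := fun j : ℤ =>
    if (r : ℤ) < |j| then gu j ^ (-(a + 1)) else 0) hpos hneg⟩
  simp only [abs_zero, not_lt.mpr (Int.natCast_nonneg r), if_false, sub_zero]
  calc S + S ≤ (r : ℝ) ^ (-a) / a + (r : ℝ) ^ (-a) / a := add_le_add hle hle
    _ = _ := by ring

end Tails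

section Parameters

theorem zeta_abs (x : ℝ) : zeta |x| = zeta x := by simp [zeta, gu]

theorem zeta_pos (x : ℝ) : 0 < zeta x :=
  div_pos (lt_max_of_lt_left one_pos) (lt_max_of_lt_left one_pos)

/-- A bandwidth `r` of order `1 / zeta L` together with a number `N` of Neumann terms for which
the truncated series has total bandwidth below `L`. -/
theorem exists_bandwidth {a q δ : ℝ} (ha : 0 < a) (hq0 : 0 < q) (hq1 : q < 1) (hδ : 0 < δ) :
    ∃ b z₀ : ℝ, 0 < b ∧ 0 < z₀ ∧ ∀ L : ℕ, zeta L ≤ z₀ → ∃ r N : ℕ, 1 ≤ r ∧ N * r < L ∧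
      (r : ℝ) ^ (-a) ≤ δ ∧ q ^ (N + 1) ≤ zeta L ^ a ∧ (r : ℝ) ^ (-a) ≤ b * zeta L ^ a := by
  have hlog : Real.log q < 0 := Real.log_neg hq0 hq1
  set A := a / -Real.log q with hA
  have hA0 : 0 < A := div_pos ha (by linarith)
  have hlogA : Real.log q * A = -a := by
    rw [hA]
    field_simp [hlog.ne]
  refine ⟨(2 * A) ^ a, min (1 / 2) (min (1 / A) (δ ^ (1 / a) / (2 * A))), by positivity,
    by positivity, fun L hL => ?_⟩
  obtain ⟨hz1, hz2⟩ := le_min_iff.mp hL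
  obtain ⟨hz2, hz3⟩ := le_min_iff.mp hz2
  have hz0 := zeta_pos L
  have hL1 : 1 ≤ L := by
    rw [Nat.one_le_iff_ne_zero]
    rintro rfl
    norm_num [zeta, gu] at hz1
  have hLR : (1 : ℝ) ≤ L := by exact_mod_cast hL1
  have hzeta : zeta L = max 1 (Real.log L) / L := by simp [zeta, gu, hLR]
  set z := zeta L
  have hAz : 0 < A * z := by positivity
  have hx1 : 1 ≤ 1 / (A * z) := by
    rw [le_div_iff₀ hAz]
    rw [le_div_iff₀ hA0] at hz2
    linarith
  set r := ⌊1 / (A * z)⌋₊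
  have hr1 : 1 ≤ r := Nat.le_floor (by simpa using hx1)
  have hrR : (1 : ℝ) ≤ r := by exact_mod_cast hr1
  have hrle : (r : ℝ) ≤ 1 / (A * z) := Nat.floor_le (by positivity)
  have hrge : (2 * A * z)⁻¹ ≤ r := by
    have h := Nat.lt_floor_add_one (1 / (A * z))
    have e : (2 * A * z)⁻¹ = 1 / (A * z) / 2 := by field_simp
    rw [e]
    linarith
  have hra : (r : ℝ) ^ (-a) ≤ (2 * A * z) ^ a := by
    refine (Real.rpow_le_rpow_of_nonpos (by positivity) hrge (by linarith)).trans_eq ?_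
    rw [Real.inv_rpow (by positivity), Real.rpow_neg (by positivity), inv_inv]
  refine ⟨r, (L - 1) / r, hr1, ?_, hra.trans ?_, ?_, hra.trans_eq ?_⟩
  · have := Nat.div_mul_le_self (L - 1) r
    omega
  · rw [le_div_iff₀ (by positivity)] at hz3
    calc (2 * A * z) ^ a ≤ (δ ^ (1 / a)) ^ a :=
          Real.rpow_le_rpow (by positivity) (by linarith) ha.le
      _ = δ := by rw [← Real.rpow_mul hδ.le, one_div_mul_cancel ha.ne', Real.rpow_one]
  · have hN : L ≤ ((L - 1) / r + 1) * r := by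
      have := Nat.lt_div_mul_add (a := L - 1) hr1
      rw [Nat.succ_mul]
      omega
    have hNR : (L : ℝ) ≤ (((L - 1) / r + 1 : ℕ) : ℝ) * r := by exact_mod_cast hN
    set n := (L - 1) / r + 1
    have hAl : A * Real.log L ≤ n := by
      have h1 : (L : ℝ) ≤ n * (1 / (A * z)) := hNR.trans (by gcongr)
      have h2 : A * z * L ≤ n := by
        rw [mul_one_div, le_div_iff₀ hAz] at h1
        linarith
      have h3 : z * L = max 1 (Real.log L) := by rw [hzeta]; field_simp
      have h4 : A * Real.log L ≤ A * (z * L) := by rw [h3]; gcongr; exact le_max_right _ _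
      linarith
    have hLz : (L : ℝ)⁻¹ ≤ z := by
      rw [hzeta, inv_eq_one_div]
      gcongr
      exact le_max_left _ _
    calc q ^ n = Real.exp (Real.log q * n) := by
          rw [← Real.rpow_natCast, Real.rpow_def_of_pos hq0]
      _ ≤ Real.exp (Real.log q * (A * Real.log L)) :=
          Real.exp_le_exp.mpr (mul_le_mul_of_nonpos_left hAl hlog.le)
      _ = ((L : ℝ)⁻¹) ^ a := by
          rw [← mul_assoc, hlogA, Real.inv_rpow (by positivity), ← Real.rpow_neg (by positivity),
            Real.rpow_def_of_pos (by positivity)]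
          ring_nf
      _ ≤ z ^ a := Real.rpow_le_rpow (by positivity) hLz ha.le
  · exact Real.mul_rpow (by positivity) hz0.le

end Parameters

theorem specNorm_blk {p : ℕ} (A : Hp p →L[ℝ] Hp p) (t τ : ℤ) :
    specNorm (blk A t τ) = ‖blockCLM A t τ‖ := by
  unfold specNorm
  congr 1
  refine ContinuousLinearMap.coe_injective
    ((EuclideanSpace.basisFun (Fin p) ℝ).toBasis.ext fun b => ?_)
  ext i
  have h : inner ℝ (bvec p t i) (A (bvec p τ b)) = A (bvec p τ b) t i := by
    rw [bvec, lp.inner_single_left, EuclideanSpace.inner_single_left]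
    simp
  simpa [Matrix.toEuclideanLin, blk, blockCLM_apply, bvec] using h

namespace AssumptionA

variable {p : ℕ} {K κ lamInf lamSup : ℝ} {C : Hp p →L[ℝ] Hp p}

theorem norm_one_sub_smul_le (hC : AssumptionA p K κ lamInf lamSup C) {μ : ℝ} (hμ : 0 < μ)
    (hSup : μ * lamSup ≤ 1) (hInf : μ * lamInf < 1) : ‖1 - μ • C‖ ≤ 1 - μ * lamInf := by
  have hform : ∀ x, inner ℝ x ((1 - μ • C) x) = ‖x‖ ^ 2 - μ * inner ℝ x (C x) := fun x => by
    rw [sub_apply, smul_apply, inner_sub_right, real_inner_smul_right]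
    rw [← real_inner_self_eq_norm_sq]
    rfl
  refine norm_le_of_symmetric_of_inner_bounds (by linarith) (fun x y => ?_) (fun x => ?_)
    fun x => ?_
  · have h := hC.symm x y
    simp only [sub_apply, smul_apply, inner_sub_left, inner_sub_right, real_inner_smul_left,
      real_inner_smul_right, h]
    rfl
  · rw [hform]
    have h1 := mul_le_mul_of_nonneg_left (hC.upper x) hμ.le
    have h2 := mul_le_mul_of_nonneg_right hSup (sq_nonneg ‖x‖)
    linarith
  · rw [hform]
    have h1 := mul_le_mul_of_nonneg_left (hC.lower x) hμ.le
    linarith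

theorem exists_banded_approximation (hC : AssumptionA p K κ lamInf lamSup C) (hκ : 1 < κ) {r : ℕ}
    (hr : 1 ≤ r) : ∃ T : Hp p →L[ℝ] Hp p,
      ‖T‖ ≤ max K 1 * (2 / (κ - 1)) * (r : ℝ) ^ (-(κ - 1)) ∧ HasBandwidth (C - T) r := by
  have hK : 0 < max K 1 := lt_max_of_lt_right one_pos
  obtain ⟨s, hs, hsum⟩ := exists_hasSum_int_tail_rpow (sub_pos.mpr hκ) hr
  have hsum' := hsum.mul_left (max K 1)
  simp only [mul_ite, mul_zero, sub_add_cancel] at hsum'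
  obtain ⟨T, hT, hband⟩ := _root_.exists_banded_approximation C r hsum' fun t τ h => by
    rw [← specNorm_blk]
    refine (hC.decay t τ h).trans ?_
    push_cast
    have : 0 ≤ gu ((t : ℝ) - τ) ^ (-κ) :=
      Real.rpow_nonneg (zero_le_one.trans (le_max_left _ _)) _
    gcongr
    exact le_max_left _ _
  refine ⟨T, hT.trans ?_, hband⟩
  rw [mul_assoc]
  gcongr

theorem exists_inverse (hC : AssumptionA p K κ lamInf lamSup C) (hInf : 0 < lamInf)
    (hle : lamInf ≤ lamSup) : ∃ D : Hp p →L[ℝ] Hp p, C * D = 1 ∧ D * C = 1 := by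
  have hSup : 0 < lamSup := hInf.trans_le hle
  set μ := 1 / (2 * lamSup) with hμ
  have hμ0 : 0 < μ := by positivity
  have hμs : μ * lamSup = 1 / 2 := by rw [hμ]; field_simp
  have hμi : μ * lamInf ≤ 1 / 2 := hμs ▸ mul_le_mul_of_nonneg_left hle hμ0.le
  have hB := hC.norm_one_sub_smul_le hμ0 (by linarith) (by linarith)
  have hlt : ‖1 - μ • C‖ < 1 := hB.trans_lt (by linarith [mul_pos hμ0 hInf])
  obtain ⟨u, hu⟩ := isUnit_one_sub_of_norm_lt_one hlt
  rw [sub_sub_cancel] at hu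
  refine ⟨μ • (↑u⁻¹ : Hp p →L[ℝ] Hp p), ?_, ?_⟩
  · rw [mul_smul_comm, ← smul_mul_assoc, ← hu, Units.mul_inv]
  · rw [smul_mul_assoc, ← mul_smul_comm, ← hu, Units.inv_mul]

end AssumptionA

/-- Theorem 2.1, bound (2.1): decay of the blocks of the inverse covariance operator. -/
theorem inverse_covariance_decay (K κ lamInf lamSup : ℝ)
    (hκ : 1 < κ) (hInf : 0 < lamInf) (hle : lamInf ≤ lamSup) :
    ∃ 𝒦 : ℝ, 0 < 𝒦 ∧
      ∀ (p : ℕ), 1 ≤ p → ∀ (C : Hp p →L[ℝ] Hp p), AssumptionA p K κ lamInf lamSup C →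
        ∃ D : Hp p →L[ℝ] Hp p,
          C.comp D = ContinuousLinearMap.id ℝ (Hp p) ∧
          D.comp C = ContinuousLinearMap.id ℝ (Hp p) ∧
          ∀ t τ : ℤ, specNorm (blk D t τ) ≤ 𝒦 * zeta ((t : ℝ) - (τ : ℝ)) ^ (κ - 1) := by
  have ha : 0 < κ - 1 := sub_pos.mpr hκ
  have hSup : 0 < lamSup := hInf.trans_le hle
  set μ := 1 / (2 * lamSup) with hμ
  have hμ0 : 0 < μ := by positivity
  have hμs : μ * lamSup = 1 / 2 := by rw [hμ]; field_simp
  have hμi : μ * lamInf ≤ 1 / 2 := hμs ▸ mul_le_mul_of_nonneg_left hle hμ0.le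
  have hμi0 : 0 < μ * lamInf := mul_pos hμ0 hInf
  set q := 1 - μ * lamInf / 2 with hq
  set c := max K 1 * (2 / (κ - 1)) with hc
  have hc0 : 0 < c := mul_pos (lt_max_of_lt_right one_pos) (by positivity)
  have hq0 : 0 < q := by linarith
  have hq1 : 0 < 1 - q := by linarith
  obtain ⟨b, z₀, hb, hz₀, hpar⟩ := exists_bandwidth (q := q) (δ := lamInf / (2 * c)) ha
    hq0 (by linarith) (by positivity)
  refine ⟨lamInf⁻¹ * (1 + μ * (c * b) / (1 - q) + (z₀ ^ (κ - 1))⁻¹), by positivity,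
    fun p _ C hC => ?_⟩
  obtain ⟨D, hCD, hDC⟩ := hC.exists_inverse hInf hle
  have hD : ‖D‖ ≤ lamInf⁻¹ := norm_le_inv_of_coercive hInf hC.lower hCD
  refine ⟨D, hCD, hDC, fun t τ => ?_⟩
  rw [specNorm_blk]
  have hL : zeta ((t : ℝ) - τ) = zeta ((t - τ).natAbs : ℝ) := by
    rw [Nat.cast_natAbs, Int.cast_abs, zeta_abs, Int.cast_sub]
  rw [hL]
  set L := (t - τ).natAbs with hLdef
  have hz := zeta_pos L
  have hza : 0 < zeta L ^ (κ - 1) := by positivity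
  rcases le_or_gt (zeta L) z₀ with h | h
  · obtain ⟨r, N, hr, hN, hδ, hqN, hrb⟩ := hpar L h
    obtain ⟨T, hT, hband⟩ := hC.exists_banded_approximation hκ hr
    rw [← hc] at hT
    have hB : ‖1 - μ • (C - T)‖ ≤ q := by
      have hB0 := hC.norm_one_sub_smul_le hμ0 (by linarith) (by linarith)
      have hT' : μ * ‖T‖ ≤ μ * lamInf / 2 := by
        have h1 := hT.trans (mul_le_mul_of_nonneg_left hδ hc0.le)
        have h2 : c * (lamInf / (2 * c)) = lamInf / 2 := by field_simp
        rw [h2] at h1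
        linarith [mul_le_mul_of_nonneg_left h1 hμ0.le]
      have e : 1 - μ • (C - T) = (1 - μ • C) + μ • T := by rw [smul_sub]; abel
      rw [e]
      refine (norm_add_le _ _).trans ?_
      rw [norm_smul, Real.norm_of_nonneg hμ0.le]
      linarith
    have hdist : ((N * r : ℕ) : ℤ) < |t - τ| := by
      rw [Int.abs_eq_natAbs]
      exact_mod_cast hN
    refine (norm_blockCLM_inverse_le hDC hband hμ0.le hT (by linarith) hB N hdist).trans ?_
    rw [mul_assoc lamInf⁻¹]
    refine mul_le_mul hD ?_ (by positivity) (by positivity)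
    have h1 : μ * (c * (r : ℝ) ^ (-(κ - 1))) / (1 - q)
        ≤ μ * (c * (b * zeta L ^ (κ - 1))) / (1 - q) := by gcongr
    have h2 : 0 ≤ (z₀ ^ (κ - 1))⁻¹ * zeta L ^ (κ - 1) := by positivity
    have h3 : μ * (c * (b * zeta L ^ (κ - 1))) / (1 - q)
        = μ * (c * b) / (1 - q) * zeta L ^ (κ - 1) := by ring
    linarith
  · refine (norm_blockCLM_le _ _ _).trans (hD.trans ?_)
    rw [mul_assoc lamInf⁻¹]
    refine le_mul_of_one_le_right (by positivity) ?_
    have h1 : 1 ≤ (z₀ ^ (κ - 1))⁻¹ * zeta L ^ (κ - 1) := by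
      rw [inv_mul_eq_div, one_le_div (by positivity)]
      exact Real.rpow_le_rpow hz₀.le h.le ha.le
    have h2 : 0 ≤ (1 + μ * (c * b) / (1 - q)) * zeta L ^ (κ - 1) := by positivity
    linarith
end
end

section
/- Baxter-type inequality, pointwise bound (Theorem 2.2, bound (2.5)). Fix constants K < ∞, κ > 3/2 and 0 < λ_inf ≤ λ_sup < ∞. Then there exists a constant 𝒦 < ∞, depending only on K, κ, λ_inf, λ_sup, such that for every p ∈ ℕ, every operator 𝐂 satisfying Assumption A(p, K, κ, λ_inf, λ_sup), every T ∈ ℤ, every d ∈ ℕ and every 1 ≤ j ≤ d: ‖Φ_{T,d,j} − Φ_{T,j}‖₂ ≤ 𝒦 ζ(d)^{κ−3/2} ζ(d−j)^{κ−3/2}. -/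
noncomputable section

/-- The VAR(∞) coefficient `Φ_{T,j} = −([𝐂(−∞,T)⁻¹]_{T,T})⁻¹ [𝐂(−∞,T)⁻¹]_{T,T−j}`,
expressed in terms of the inverse `DT` of the one-sided compression `𝐂(−∞,T)`. -/
def PhiInf {p : ℕ} {T : ℤ}
    (DT : HpI {t : ℤ // t ≤ T} p →L[ℝ] HpI {t : ℤ // t ≤ T} p) (j : ℕ) :
    Matrix (Fin p) (Fin p) ℝ :=
  - ((blk DT ⟨T, le_refl T⟩ ⟨T, le_refl T⟩)⁻¹ * blk DT ⟨T, le_refl T⟩ ⟨T - (j : ℤ), by omega⟩)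

/-- The finite-order prediction coefficient
`Φ_{T,d,j} = −([𝐂(T−d,T)⁻¹]_{T,T})⁻¹ [𝐂(T−d,T)⁻¹]_{T,T−j}`, expressed in terms of the
inverse `Dd` of the finite section `𝐂(T−d,T)`. -/
def PhiFin {p : ℕ} {T : ℤ} {d : ℕ}
    (Dd : HpI {t : ℤ // T - (d : ℤ) ≤ t ∧ t ≤ T} p →L[ℝ]
          HpI {t : ℤ // T - (d : ℤ) ≤ t ∧ t ≤ T} p)
    (j : ℕ) (hj : j ≤ d) : Matrix (Fin p) (Fin p) ℝ :=
  - ((blk Dd ⟨T, by omega⟩ ⟨T, by omega⟩)⁻¹ * blk Dd ⟨T, by omega⟩ ⟨T - (j : ℤ), by omega⟩)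

open scoped RealInnerProductSpace

section Restriction

variable {α β : Type} {p : ℕ}

/-- Restriction of sequences along an injective map of index sets. -/
def restrL (p : ℕ) (f : α → β) (hf : Function.Injective f) : HpI β p →L[ℝ] HpI α p :=
  LinearMap.mkContinuous
    { toFun := fun x => ⟨fun i => x (f i), by
        have h := (lp.memℓp x).summable (by norm_num)
        exact memℓp_gen (h.comp_injective hf)⟩
      map_add' := fun _ _ => rfl
      map_smul' := fun _ _ => rfl } 1 fun x => by
    have h2 : (0 : ℝ) < (2 : ENNReal).toReal := by norm_num
    rw [one_mul]
    refine le_of_pow_le_pow_left₀ two_ne_zero (norm_nonneg _) ?_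
    have hx := lp.hasSum_norm h2 x
    have hy := lp.hasSum_norm h2 (⟨fun i => x (f i),
      memℓp_gen ((lp.memℓp x).summable h2 |>.comp_injective hf)⟩ : HpI α p)
    have key := hy.summable.tsum_le_tsum_of_inj f hf (fun c _ => by positivity)
      (fun i => le_rfl) hx.summable
    rw [hy.tsum_eq, hx.tsum_eq] at key
    simp only [ENNReal.toReal_ofNat, Real.rpow_ofNat] at key
    exact key

theorem inner_single_hpI [DecidableEq α] (i : α) (u : EuclideanSpace ℝ (Fin p)) (x : HpI α p) :
    ⟪lp.single 2 i u, x⟫ = ⟪u, x i⟫ :=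
  lp.inner_single_left i u x

theorem restrL_apply {f : α → β} (hf : Function.Injective f) (x : HpI β p) (i : α) :
    restrL p f hf x i = x (f i) := rfl

theorem norm_restrL_le {f : α → β} (hf : Function.Injective f) : ‖restrL p f hf‖ ≤ 1 :=
  LinearMap.mkContinuous_norm_le _ zero_le_one _

/-- Extension by zero along an injective map of index sets. -/
def embL (p : ℕ) (f : α → β) (hf : Function.Injective f) : HpI α p →L[ℝ] HpI β p :=
  ContinuousLinearMap.adjoint (restrL p f hf)

theorem norm_embL_le {f : α → β} (hf : Function.Injective f) : ‖embL p f hf‖ ≤ 1 := by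
  rw [embL, LinearIsometryEquiv.norm_map]
  exact norm_restrL_le hf

theorem inner_embL_left {f : α → β} (hf : Function.Injective f) (x : HpI α p) (y : HpI β p) :
    ⟪embL p f hf x, y⟫ = ⟪x, restrL p f hf y⟫ :=
  ContinuousLinearMap.adjoint_inner_left _ _ _

theorem inner_embL_right {f : α → β} (hf : Function.Injective f) (x : HpI α p) (y : HpI β p) :
    ⟪y, embL p f hf x⟫ = ⟪restrL p f hf y, x⟫ :=
  ContinuousLinearMap.adjoint_inner_right _ _ _

theorem embL_single [DecidableEq α] [DecidableEq β] {f : α → β} (hf : Function.Injective f)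
    (k : α) (u : EuclideanSpace ℝ (Fin p)) :
    embL p f hf (lp.single 2 k u) = lp.single 2 (f k) u := by
  refine ext_inner_right ℝ fun y => ?_
  rw [inner_embL_left, lp.inner_single_left, lp.inner_single_left, restrL_apply]

theorem restrL_single [DecidableEq α] [DecidableEq β] {f : α → β} (hf : Function.Injective f)
    (k : α) (u : EuclideanSpace ℝ (Fin p)) :
    restrL p f hf (lp.single 2 (f k) u) = lp.single 2 k u := by
  ext1
  funext j
  rw [restrL_apply, lp.single_apply, lp.single_apply]
  by_cases h : j = k
  · subst h; simp
  · rw [Pi.single_eq_of_ne h, Pi.single_eq_of_ne (hf.ne h)]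

theorem embL_apply {f : α → β} (hf : Function.Injective f) (y : HpI α p) (k : α) :
    embL p f hf y (f k) = y k := by
  classical
  refine ext_inner_left ℝ fun u => ?_
  refine (inner_single_hpI (f k) u (embL p f hf y)).symm.trans ?_
  refine Eq.trans ?_ (inner_single_hpI k u y)
  rw [inner_embL_right, restrL_single]

theorem embL_apply_of_notMem {f : α → β} (hf : Function.Injective f) (y : HpI α p) {i : β}
    (hi : i ∉ Set.range f) : embL p f hf y i = 0 := by
  classical
  refine ext_inner_left ℝ fun u => ?_
  refine (inner_single_hpI i u (embL p f hf y)).symm.trans ?_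
  rw [inner_embL_right, inner_zero_right]
  suffices restrL p f hf (lp.single 2 i u) = 0 by rw [this, inner_zero_left]
  ext1
  funext j
  rw [restrL_apply, lp.single_apply, Pi.single_eq_of_ne fun h => hi ⟨j, h⟩]
  rfl

theorem restrL_embL {f : α → β} (hf : Function.Injective f) (y : HpI α p) :
    restrL p f hf (embL p f hf y) = y := by
  ext1
  funext j
  rw [restrL_apply, embL_apply]

theorem norm_embL {f : α → β} (hf : Function.Injective f) (y : HpI α p) :
    ‖embL p f hf y‖ = ‖y‖ := by
  rw [← sq_eq_sq₀ (norm_nonneg _) (norm_nonneg _), ← real_inner_self_eq_norm_sq, inner_embL_left,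
    restrL_embL, real_inner_self_eq_norm_sq]

/-- The coordinate projection onto the indices in `S`. -/
def projL (p : ℕ) (S : Set α) : HpI α p →L[ℝ] HpI α p :=
  embL p ((↑) : S → α) Subtype.val_injective ∘L restrL p ((↑) : S → α) Subtype.val_injective

theorem projL_apply_of_mem {S : Set α} {i : α} (hi : i ∈ S) (x : HpI α p) :
    projL p S x i = x i :=
  embL_apply Subtype.val_injective _ (⟨i, hi⟩ : S)

theorem projL_apply_of_notMem {S : Set α} {i : α} (hi : i ∉ S) (x : HpI α p) :
    projL p S x i = 0 :=
  embL_apply_of_notMem Subtype.val_injective _ fun ⟨k, hk⟩ => hi (hk ▸ k.2)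

theorem norm_projL_le (S : Set α) : ‖projL p S‖ ≤ 1 :=
  (ContinuousLinearMap.opNorm_comp_le _ _).trans
    (mul_le_one₀ (norm_embL_le _) (norm_nonneg _) (norm_restrL_le _))

theorem projL_add_projL_compl (S : Set α) (x : HpI α p) : projL p S x + projL p Sᶜ x = x := by
  ext1
  funext i
  rw [lp.coeFn_add, Pi.add_apply]
  by_cases hi : i ∈ S
  · rw [projL_apply_of_mem hi, projL_apply_of_notMem (by simpa using hi), add_zero]
  · rw [projL_apply_of_notMem hi, projL_apply_of_mem (by simpa using hi), zero_add]

theorem inner_projL_left (S : Set α) (x y : HpI α p) :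
    ⟪projL p S x, y⟫ = ⟪x, projL p S y⟫ := by
  simp only [projL, ContinuousLinearMap.comp_apply]
  rw [inner_embL_left, inner_embL_right]

theorem projL_eq_self {S : Set α} {x : HpI α p} (h : ∀ i ∉ S, x i = 0) : projL p S x = x := by
  ext1
  funext i
  by_cases hi : i ∈ S
  · rw [projL_apply_of_mem hi]
  · rw [projL_apply_of_notMem hi, h i hi]

theorem projL_eq_zero {S : Set α} {x : HpI α p} (h : ∀ i ∈ S, x i = 0) : projL p S x = 0 := by
  ext1
  funext i
  by_cases hi : i ∈ S
  · rw [projL_apply_of_mem hi, h i hi]; rfl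
  · rw [projL_apply_of_notMem hi]; rfl

theorem projL_single_of_mem [DecidableEq α] {S : Set α} {i : α} (hi : i ∈ S)
    (u : EuclideanSpace ℝ (Fin p)) : projL p S (lp.single 2 i u) = lp.single 2 i u :=
  projL_eq_self fun j hj => by
    rw [lp.single_apply, Pi.single_eq_of_ne]
    rintro rfl
    exact hj hi

theorem projL_single_of_notMem [DecidableEq α] {S : Set α} {i : α} (hi : i ∉ S)
    (u : EuclideanSpace ℝ (Fin p)) : projL p S (lp.single 2 i u) = 0 :=
  projL_eq_zero fun j hj => by
    rw [lp.single_apply, Pi.single_eq_of_ne]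
    rintro rfl
    exact hi hj

theorem projL_projL (S : Set α) (x : HpI α p) : projL p S (projL p S x) = projL p S x :=
  projL_eq_self fun _ hi => projL_apply_of_notMem hi x

theorem projL_projL_of_disjoint {S S' : Set α} (h : Disjoint S S') (x : HpI α p) :
    projL p S (projL p S' x) = 0 :=
  projL_eq_zero fun _ hi => projL_apply_of_notMem (Set.disjoint_left.1 h hi) x

theorem projL_embL {f : α → β} (hf : Function.Injective f) (A : Set β) (y : HpI α p) :
    projL p A (embL p f hf y) = embL p f hf (projL p (f ⁻¹' A) y) := by
  ext1
  funext i
  by_cases hr : i ∈ Set.range f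
  · obtain ⟨k, rfl⟩ := hr
    rw [embL_apply]
    by_cases hi : f k ∈ A
    · rw [projL_apply_of_mem hi, projL_apply_of_mem (by exact hi), embL_apply]
    · rw [projL_apply_of_notMem hi, projL_apply_of_notMem (by exact hi)]
  · rw [embL_apply_of_notMem _ _ hr]
    by_cases hi : i ∈ A
    · rw [projL_apply_of_mem hi, embL_apply_of_notMem _ _ hr]
    · rw [projL_apply_of_notMem hi]

theorem restrL_projL {f : α → β} (hf : Function.Injective f) (B : Set β) (x : HpI β p) :
    restrL p f hf (projL p B x) = projL p (f ⁻¹' B) (restrL p f hf x) := by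
  ext1
  funext k
  rw [restrL_apply]
  by_cases hi : f k ∈ B
  · rw [projL_apply_of_mem hi, projL_apply_of_mem (by exact hi), restrL_apply]
  · rw [projL_apply_of_notMem hi, projL_apply_of_notMem (by exact hi)]

theorem embL_restrL {f : α → β} (hf : Function.Injective f) (x : HpI β p) :
    embL p f hf (restrL p f hf x) = projL p (Set.range f) x := by
  ext1
  funext i
  by_cases hr : i ∈ Set.range f
  · rw [projL_apply_of_mem hr]
    obtain ⟨k, rfl⟩ := hr
    rw [embL_apply, restrL_apply]
  · rw [projL_apply_of_notMem hr, embL_apply_of_notMem _ _ hr]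

end Restriction

section Blocks

variable {ι κ : Type} [DecidableEq ι] [DecidableEq κ] {p : ℕ}

open Matrix in
theorem inner_toEuclideanCLM_blk (X : HpI ι p →L[ℝ] HpI ι p) (t τ : ι)
    (u v : EuclideanSpace ℝ (Fin p)) :
    ⟪u, toEuclideanCLM (𝕜 := ℝ) (blk X t τ) v⟫ = ⟪lp.single 2 t u, X (lp.single 2 τ v)⟫ := by
  have hs : ∀ (i : ι) (w : EuclideanSpace ℝ (Fin p)),
      (lp.single 2 i w : HpI ι p) = ∑ a, w a • bvec p i a := by
    intro i w
    conv_lhs => rw [← (EuclideanSpace.basisFun (Fin p) ℝ).sum_repr w]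
    have := map_sum (lp.singleContinuousLinearMap ℝ (fun _ : ι => EuclideanSpace ℝ (Fin p)) 2 i)
      (fun a => (EuclideanSpace.basisFun (Fin p) ℝ).repr w a •
        EuclideanSpace.basisFun (Fin p) ℝ a) Finset.univ
    rw [lp.singleContinuousLinearMap_apply] at this
    rw [this]
    refine Finset.sum_congr rfl fun a _ => ?_
    simp [bvec]
  rw [inner_toEuclideanCLM, hs t u, hs τ v]
  simp only [map_sum, map_smul, sum_inner, inner_sum, inner_smul_left, inner_smul_right,
    dotProduct, mulVec, Finset.mul_sum, blk, of_apply]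
  rw [Finset.sum_comm]
  refine Finset.sum_congr rfl fun a _ => Finset.sum_congr rfl fun b _ => ?_
  simp only [conj_trivial]
  ring

theorem norm_inner_single_le (X : HpI ι p →L[ℝ] HpI ι p) (t τ : ι)
    (u v : EuclideanSpace ℝ (Fin p)) :
    |⟪lp.single 2 t u, X (lp.single 2 τ v)⟫| ≤ specNorm (blk X t τ) * (‖u‖ * ‖v‖) := by
  rw [← inner_toEuclideanCLM_blk]
  refine (abs_real_inner_le_norm _ _).trans ?_
  have : ‖Matrix.toEuclideanCLM (𝕜 := ℝ) (blk X t τ) v‖ ≤ specNorm (blk X t τ) * ‖v‖ :=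
    ContinuousLinearMap.le_opNorm (Matrix.toEuclideanCLM (𝕜 := ℝ) (blk X t τ)) v
  nlinarith [norm_nonneg u]

theorem specNorm_blk_le {X : HpI ι p →L[ℝ] HpI ι p} {t τ : ι} {c : ℝ} (hc : 0 ≤ c)
    (h : ∀ u v, ⟪lp.single 2 t u, X (lp.single 2 τ v)⟫ ≤ c * (‖u‖ * ‖v‖)) :
    specNorm (blk X t τ) ≤ c := by
  change ‖Matrix.toEuclideanCLM (𝕜 := ℝ) (blk X t τ)‖ ≤ c
  refine ContinuousLinearMap.opNorm_le_bound _ hc fun v => ?_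
  have := h (Matrix.toEuclideanCLM (𝕜 := ℝ) (blk X t τ) v) v
  rw [← inner_toEuclideanCLM_blk, real_inner_self_eq_norm_sq] at this
  by_contra! hlt
  nlinarith [norm_nonneg v, mul_nonneg hc (norm_nonneg v)]

theorem clm_ext_blk {X Y : HpI ι p →L[ℝ] HpI ι p} (h : ∀ t τ, blk X t τ = blk Y t τ) : X = Y := by
  refine lp.ext_continuousLinearMap (by norm_num) fun τ => ?_
  ext1 v
  simp only [ContinuousLinearMap.comp_apply, lp.singleContinuousLinearMap_apply]
  ext1
  funext t
  refine ext_inner_left ℝ fun u => ?_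
  refine (inner_single_hpI t u (X (lp.single 2 τ v))).symm.trans ?_
  refine Eq.trans ?_ (inner_single_hpI t u (Y (lp.single 2 τ v)))
  rw [← inner_toEuclideanCLM_blk, h, inner_toEuclideanCLM_blk]

theorem eq_compression {X : HpI ι p →L[ℝ] HpI ι p} {Y : HpI κ p →L[ℝ] HpI κ p} {f : ι → κ}
    (hf : Function.Injective f) (h : ∀ t τ, blk X t τ = blk Y (f t) (f τ)) :
    X = restrL p f hf ∘L Y ∘L embL p f hf := by
  refine clm_ext_blk fun t τ => (h t τ).trans ?_
  ext a b
  simp only [blk, Matrix.of_apply, ContinuousLinearMap.comp_apply, bvec]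
  rw [← inner_embL_left, embL_single, embL_single]

end Blocks

section OperatorNorm

variable {E : Type*} [NormedAddCommGroup E] [InnerProductSpace ℝ E]

theorem opNorm_le_of_inner_le (Y : E →L[ℝ] E) {S : ℝ} (hS : 0 ≤ S)
    (h : ∀ u v, ⟪u, Y v⟫ ≤ S / 2 * (‖u‖ ^ 2 + ‖v‖ ^ 2)) : ‖Y‖ ≤ S := by
  refine ContinuousLinearMap.opNorm_le_bound _ hS fun v => ?_
  refine le_of_sq_le_sq ?_ (by positivity)
  rcases hS.eq_or_lt with rfl | hS
  · have := h (Y v) v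
    rw [real_inner_self_eq_norm_sq] at this
    linarith
  · have := h (S⁻¹ • Y v) v
    rw [real_inner_smul_left, real_inner_self_eq_norm_sq, norm_smul, mul_pow, norm_inv,
      Real.norm_of_nonneg hS.le] at this
    have h2 := mul_le_mul_of_nonneg_left this (by positivity : 0 ≤ 2 * S)
    have e1 : 2 * S * (S⁻¹ * ‖Y v‖ ^ 2) = 2 * ‖Y v‖ ^ 2 := by field_simp
    have e2 : 2 * S * (S / 2 * (S⁻¹ ^ 2 * ‖Y v‖ ^ 2 + ‖v‖ ^ 2)) =
        ‖Y v‖ ^ 2 + (S * ‖v‖) ^ 2 := by field_simp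
    linarith

theorem opNorm_le_of_abs_form_le (X : E →L[ℝ] E) {S : ℝ} (hS : 0 ≤ S)
    (hX : ∀ x y, ⟪X x, y⟫ = ⟪x, X y⟫) (h : ∀ x, |⟪x, X x⟫| ≤ S * ‖x‖ ^ 2) : ‖X‖ ≤ S := by
  refine opNorm_le_of_inner_le X hS fun u v => ?_
  have e : ⟪u, X v⟫ = (⟪u + v, X (u + v)⟫ - ⟪u - v, X (u - v)⟫) / 4 := by
    simp only [map_add, map_sub, inner_add_left, inner_add_right, inner_sub_left, inner_sub_right]
    rw [real_inner_comm (X u) v, hX]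
    ring
  have h1 := (abs_le.1 (h (u + v))).2
  have h2 := (abs_le.1 (h (u - v))).1
  have h3 := parallelogram_law_with_norm ℝ u v
  rw [e]
  nlinarith

end OperatorNorm

section Schur

variable {ι : Type} [DecidableEq ι] {p : ℕ}

/-- Schur's test for operators with blocks dominated by a summable convolution kernel. -/
theorem opNorm_le_tsum {e : ι → ℤ} (he : Function.Injective e) (Y : HpI ι p →L[ℝ] HpI ι p)
    {g : ℤ → ℝ} (hg : ∀ s, 0 ≤ g s) (hgs : Summable g)
    (h : ∀ t τ u v, ⟪lp.single 2 t u, Y (lp.single 2 τ v)⟫ ≤ g (e t - e τ) * (‖u‖ * ‖v‖)) :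
    ‖Y‖ ≤ ∑' s, g s := by
  have hS : 0 ≤ ∑' s, g s := tsum_nonneg hg
  have hfin : ∀ (F : Finset ι) (k : ι → ℤ), Function.Injective k →
      ∑ i ∈ F, g (k i) ≤ ∑' s, g s := by
    intro F k hk
    rw [← Finset.sum_image (f := g) (g := k) fun _ _ _ _ h => hk h]
    exact hgs.sum_le_tsum _ fun _ _ => hg _
  have hnorm : ∀ (F : Finset ι) (u : HpI ι p), ∑ i ∈ F, ‖u i‖ ^ 2 ≤ ‖u‖ ^ 2 := by
    intro F u
    have := lp.hasSum_norm (p := 2) (by norm_num) u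
    simp only [ENNReal.toReal_ofNat, Real.rpow_ofNat] at this
    exact sum_le_hasSum F (fun _ _ => by positivity) this
  refine opNorm_le_of_inner_le Y hS fun u v => ?_
  have hu := lp.hasSum_single (p := 2) (by norm_num) u
  have hv := lp.hasSum_single (p := 2) (by norm_num) v
  have hlim := Filter.Tendsto.inner (𝕜 := ℝ) hu ((Y.continuous.tendsto v).comp hv)
  refine le_of_tendsto' hlim fun F => ?_
  simp only [Function.comp_apply, map_sum, sum_inner, inner_sum]
  calc _ ≤ ∑ t ∈ F, ∑ τ ∈ F, (g (e t - e τ) / 2 * ‖u t‖ ^ 2 + g (e t - e τ) / 2 * ‖v τ‖ ^ 2) := by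
        rw [Finset.sum_comm]
        refine Finset.sum_le_sum fun t _ => Finset.sum_le_sum fun τ _ => (h _ _ _ _).trans ?_
        nlinarith [mul_nonneg (hg (e t - e τ)) (sq_nonneg (‖u t‖ - ‖v τ‖))]
    _ = (∑ t ∈ F, (∑ τ ∈ F, g (e t - e τ)) / 2 * ‖u t‖ ^ 2) +
        ∑ τ ∈ F, (∑ t ∈ F, g (e t - e τ)) / 2 * ‖v τ‖ ^ 2 := by
        simp only [Finset.sum_add_distrib]
        congr 1
        · simp only [Finset.sum_div, Finset.sum_mul]
        · rw [Finset.sum_comm]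
          simp only [Finset.sum_div, Finset.sum_mul]
    _ ≤ (∑ t ∈ F, (∑' s, g s) / 2 * ‖u t‖ ^ 2) + ∑ τ ∈ F, (∑' s, g s) / 2 * ‖v τ‖ ^ 2 := by
        gcongr with t _ τ _
        · exact hfin F _ ((sub_right_injective (b := e t)).comp he)
        · exact hfin F _ ((sub_left_injective (b := e τ)).comp he)
    _ = (∑' s, g s) / 2 * ((∑ t ∈ F, ‖u t‖ ^ 2) + ∑ τ ∈ F, ‖v τ‖ ^ 2) := by
        rw [mul_add, Finset.mul_sum, Finset.mul_sum]
    _ ≤ _ := by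
        gcongr
        · exact hnorm F u
        · exact hnorm F v

end Schur

section OffDiagonal

variable {ι : Type} {p : ℕ}

/-- `X` has norm at most `c` between any two index sets at distance at least `r`, the indices
being located by `e`. -/
def OffDecay (e : ι → ℤ) (X : HpI ι p →L[ℝ] HpI ι p) (r c : ℝ) : Prop :=
  ∀ A B : Set ι, (∀ a ∈ A, ∀ b ∈ B, r ≤ |(e a : ℝ) - e b|) →
    ∀ x, ‖projL p A (X (projL p B x))‖ ≤ c * ‖x‖

/-- Polynomial decay of order `α` of the off-diagonal corners of `X`. -/
def PolyDecay (e : ι → ℤ) (X : HpI ι p →L[ℝ] HpI ι p) (α M : ℝ) : Prop :=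
  ∀ r, 0 < r → OffDecay e X r (M * r ^ (-α))

theorem norm_projL_apply_le (S : Set ι) (x : HpI ι p) : ‖projL p S x‖ ≤ ‖x‖ := by
  simpa using ContinuousLinearMap.le_of_opNorm_le _ (norm_projL_le S) x

theorem OffDecay.mul {e : ι → ℤ} {X Y : HpI ι p →L[ℝ] HpI ι p} {r s c c' a b : ℝ}
    (hX : OffDecay e X r c) (hY : OffDecay e Y s c') (hc : 0 ≤ c) (ha : ‖X‖ ≤ a) (hb : ‖Y‖ ≤ b) :
    OffDecay e (X * Y) (r + s) (c * b + a * c') := by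
  intro A B hAB x
  set N : Set ι := {i | ∃ k ∈ A, |(e k : ℝ) - e i| < r}
  have h1 := hX A Nᶜ (fun k hk i hi => by
    by_contra! hlt
    exact hi ⟨k, hk, hlt⟩) (Y (projL p B x))
  have h2 := hY N B (fun i ⟨k, hk, hlt⟩ l hl => by
    have := hAB k hk l hl
    have := abs_sub_le (e k : ℝ) (e i) (e l)
    linarith) x
  have hYB : ‖Y (projL p B x)‖ ≤ b * ‖x‖ :=
    (Y.le_of_opNorm_le hb _).trans
      (mul_le_mul_of_nonneg_left (norm_projL_apply_le _ _) ((norm_nonneg _).trans hb))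
  have hXN : ‖projL p A (X (projL p N (Y (projL p B x))))‖ ≤ a * (c' * ‖x‖) :=
    (norm_projL_apply_le _ _).trans ((X.le_of_opNorm_le ha _).trans
      (mul_le_mul_of_nonneg_left h2 ((norm_nonneg _).trans ha)))
  have hsplit : projL p A ((X * Y) (projL p B x)) =
      projL p A (X (projL p N (Y (projL p B x)))) +
        projL p A (X (projL p Nᶜ (Y (projL p B x)))) := by
    rw [← map_add, ← map_add, projL_add_projL_compl]
    rfl
  rw [hsplit]
  refine (norm_add_le _ _).trans ?_
  nlinarith [mul_le_mul_of_nonneg_left hYB hc]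

theorem OffDecay.pow_succ {e : ι → ℤ} {E : HpI ι p →L[ℝ] HpI ι p} {r c q : ℝ}
    (hE : OffDecay e E r c) (hc : 0 ≤ c) (hq : ‖E‖ ≤ q) (n : ℕ) :
    OffDecay e (E ^ (n + 1)) ((n + 1) * r) ((n + 1) * q ^ n * c) := by
  induction n with
  | zero => simpa using hE
  | succ n ih =>
    have hq0 : 0 ≤ q := (norm_nonneg _).trans hq
    have h := hE.mul ih hc hq ((norm_pow_le' E n.succ_pos).trans
      (pow_le_pow_left₀ (norm_nonneg _) hq _))
    rw [← _root_.pow_succ'] at h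
    convert h using 1
    · push_cast; ring
    · rw [Nat.succ_eq_add_one]; push_cast; ring

theorem projL_projL_of_far {e : ι → ℤ} {A B : Set ι} {r : ℝ} (hr : 0 < r)
    (h : ∀ a ∈ A, ∀ b ∈ B, r ≤ |(e a : ℝ) - e b|) (x : HpI ι p) :
    projL p A (projL p B x) = 0 :=
  projL_projL_of_disjoint (Set.disjoint_left.2 fun i hA hB => by
    have := h i hA i hB
    simp only [sub_self, abs_zero] at this
    linarith) x

theorem PolyDecay.one_sub_smul {e : ι → ℤ} {C : HpI ι p →L[ℝ] HpI ι p} {α M l : ℝ}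
    (hC : PolyDecay e C α M) (hl : 0 ≤ l) : PolyDecay e (1 - l • C) α (l * M) := by
  intro r hr A B hAB x
  have : projL p A ((1 - l • C) (projL p B x)) = -(l • projL p A (C (projL p B x))) := by
    simp only [_root_.sub_apply, one_apply_eq_self,
      smul_apply, map_sub, map_smul, projL_projL_of_far hr hAB, zero_sub]
  rw [this, norm_neg, norm_smul, Real.norm_of_nonneg hl, mul_assoc, mul_assoc]
  refine mul_le_mul_of_nonneg_left ?_ hl
  rw [← mul_assoc]
  exact hC r hr A B hAB x

/-- The constant in the decay of the Neumann series of a contraction of norm `q`. -/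
def neumannConst (α q : ℝ) : ℝ := ∑' n : ℕ, ((n : ℝ) + 1) ^ (1 + α) * q ^ n

theorem summable_neumann {α q : ℝ} (hq0 : 0 ≤ q) (hq : q < 1) :
    Summable fun n : ℕ => ((n : ℝ) + 1) ^ (1 + α) * q ^ n := by
  obtain ⟨k, hk⟩ := exists_nat_ge (1 + α)
  have h1 : Summable fun n : ℕ => (n : ℝ) ^ k * ‖q‖ ^ n := by
    simpa using (summable_pow_mul_geometric_of_norm_lt_one (R := ℝ) k
      (r := ‖q‖) (by simpa [abs_of_nonneg hq0] using hq))
  have h2 : Summable fun n : ℕ => 2 ^ k * ((n : ℝ) ^ k * q ^ n) + 2 ^ k * q ^ n := by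
    rw [Real.norm_of_nonneg hq0] at h1
    exact (h1.mul_left _).add ((summable_geometric_of_lt_one hq0 hq).mul_left _)
  refine h2.of_nonneg_of_le (fun n => by positivity) fun n => ?_
  rw [← mul_assoc, ← add_mul]
  refine mul_le_mul_of_nonneg_right ?_ (pow_nonneg hq0 n)
  calc ((n : ℝ) + 1) ^ (1 + α) ≤ ((n : ℝ) + 1) ^ (k : ℝ) :=
        Real.rpow_le_rpow_of_exponent_le (by linarith [n.cast_nonneg (α := ℝ)]) hk
    _ = ((n : ℝ) + 1) ^ k := Real.rpow_natCast _ _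
    _ ≤ 2 ^ k * (n : ℝ) ^ k + 2 ^ k := by
      rcases Nat.eq_zero_or_pos n with rfl | hn
      · simp only [Nat.cast_zero, zero_add, one_pow]
        have : (1 : ℝ) ≤ 2 ^ k := one_le_pow₀ one_le_two
        nlinarith [pow_nonneg (le_refl (0 : ℝ)) k]
      · have h1n : (1 : ℝ) ≤ n := by exact_mod_cast hn
        rw [← mul_pow]
        have := pow_le_pow_left₀ (by positivity) (by linarith : (n : ℝ) + 1 ≤ 2 * n) k
        have h2k : (0 : ℝ) ≤ 2 ^ k := by positivity
        linarith

theorem PolyDecay.inverse {e : ι → ℤ} {C D : HpI ι p →L[ℝ] HpI ι p} {α M l q : ℝ}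
    (hC : PolyDecay e C α M) (hM : 0 ≤ M) (hl : 0 ≤ l) (hq : ‖1 - l • C‖ ≤ q) (hq1 : q < 1)
    (hCD : C * D = 1) : PolyDecay e D α (l * (l * M) * neumannConst α q) := by
  intro R hR A B hAB x
  set E := 1 - l • C with hE
  have hq0 : 0 ≤ q := (norm_nonneg _).trans hq
  have hterm : ∀ n : ℕ, ‖projL p A ((E ^ (n + 1)) (projL p B x))‖ ≤
      (((n : ℝ) + 1) ^ (1 + α) * q ^ n) * (l * M * R ^ (-α) * ‖x‖) := by
    intro n
    have hn : (0 : ℝ) < n + 1 := by positivity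
    have h := ((hC.one_sub_smul hl) (R / (n + 1)) (by positivity)).pow_succ (by positivity) hq n
    rw [mul_div_cancel₀ _ hn.ne'] at h
    refine (h A B hAB x).trans (le_of_eq ?_)
    rw [Real.div_rpow hR.le hn.le, Real.rpow_neg hn.le, div_inv_eq_mul, Real.rpow_add hn,
      Real.rpow_one]
    ring
  have hgeom : ∀ N : ℕ, D = l • ∑ i ∈ Finset.range N, E ^ i + E ^ N * D := by
    intro N
    have h1 : (∑ i ∈ Finset.range N, E ^ i) * (1 - E) = 1 - E ^ N := geom_sum_mul_neg E N
    have h2 : (1 - E) * D = l • (1 : HpI ι p →L[ℝ] HpI ι p) := by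
      rw [hE, sub_sub_cancel, smul_mul_assoc, hCD]
    have h3 := congrArg (· * D) h1
    simp only [mul_assoc, h2, sub_mul, one_mul, mul_smul_comm, mul_one] at h3
    rw [h3, sub_add_cancel]
  have hbound : ∀ N : ℕ, ‖projL p A (D (projL p B x))‖ ≤
      l * (neumannConst α q * (l * M * R ^ (-α) * ‖x‖)) + q ^ (N + 1) * (‖D‖ * ‖x‖) := by
    intro N
    have e1 : projL p A (D (projL p B x)) =
        l • (∑ n ∈ Finset.range N, projL p A ((E ^ (n + 1)) (projL p B x))) +
          projL p A ((E ^ (N + 1)) (D (projL p B x))) := by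
      conv_lhs => rw [hgeom (N + 1)]
      rw [Finset.sum_range_succ']
      simp only [pow_zero, _root_.add_apply, smul_apply,
        sum_apply, one_apply_eq_self, map_add, map_smul, map_sum,
        projL_projL_of_far hR hAB, add_zero]
      rfl
    rw [e1]
    refine (norm_add_le _ _).trans (add_le_add ?_ ?_)
    · rw [norm_smul, Real.norm_of_nonneg hl]
      refine mul_le_mul_of_nonneg_left ?_ hl
      refine (norm_sum_le _ _).trans ((Finset.sum_le_sum fun n _ => hterm n).trans ?_)
      rw [← Finset.sum_mul]
      exact mul_le_mul_of_nonneg_right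
        ((summable_neumann hq0 hq1).sum_le_tsum _ fun n _ => by positivity) (by positivity)
    · refine (norm_projL_apply_le _ _).trans ?_
      refine (ContinuousLinearMap.le_of_opNorm_le _ ((norm_pow_le' E N.succ_pos).trans
        (pow_le_pow_left₀ (norm_nonneg _) hq _)) _).trans ?_
      refine mul_le_mul_of_nonneg_left ?_ (pow_nonneg hq0 _)
      exact (D.le_opNorm _).trans
        (mul_le_mul_of_nonneg_left (norm_projL_apply_le _ _) (norm_nonneg _))
  have hlim : Filter.Tendsto (fun N : ℕ =>
      l * (neumannConst α q * (l * M * R ^ (-α) * ‖x‖)) + q ^ (N + 1) * (‖D‖ * ‖x‖))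
      Filter.atTop (nhds (l * (neumannConst α q * (l * M * R ^ (-α) * ‖x‖)) +
        0 * (‖D‖ * ‖x‖))) :=
    (((Filter.tendsto_add_atTop_iff_nat 1).2
      (tendsto_pow_atTop_nhds_zero_of_lt_one hq0 hq1)).mul_const _).const_add _
  refine (ge_of_tendsto' hlim hbound).trans (le_of_eq ?_)
  ring

end OffDiagonal

section Matrices

open scoped Matrix.Norms.L2Operator

open Matrix

variable {n : Type*} [Fintype n] [DecidableEq n]

theorem isUnit_of_coercive {A : Matrix n n ℝ} {a : ℝ} (ha : 0 < a)
    (h : ∀ u, a * ‖u‖ ^ 2 ≤ ⟪u, toEuclideanCLM (𝕜 := ℝ) A u⟫) : IsUnit A := by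
  rw [← mulVec_injective_iff_isUnit, ← coe_mulVecLin, ← LinearMap.ker_eq_bot,
    LinearMap.ker_eq_bot']
  intro v hv
  have := h (WithLp.toLp 2 v)
  rw [toEuclideanCLM_toLp, ← mulVecLin_apply, hv, WithLp.toLp_zero, inner_zero_right] at this
  have h0 : ‖WithLp.toLp 2 v‖ = 0 := by
    have : ‖WithLp.toLp 2 v‖ ^ 2 ≤ 0 := by
      by_contra! hlt
      nlinarith [mul_pos ha hlt]
    exact pow_eq_zero_iff two_ne_zero |>.1 (le_antisymm this (sq_nonneg _))
  simpa using h0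

theorem norm_inv_le_of_coercive {A : Matrix n n ℝ} {a : ℝ} (ha : 0 < a)
    (h : ∀ u, a * ‖u‖ ^ 2 ≤ ⟪u, toEuclideanCLM (𝕜 := ℝ) A u⟫) : ‖A⁻¹‖ ≤ a⁻¹ := by
  have hA := isUnit_of_coercive ha h
  change ‖toEuclideanCLM (𝕜 := ℝ) A⁻¹‖ ≤ a⁻¹
  refine ContinuousLinearMap.opNorm_le_bound _ (by positivity) fun w => ?_
  have hw : toEuclideanCLM (𝕜 := ℝ) A (toEuclideanCLM (𝕜 := ℝ) A⁻¹ w) = w := by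
    change (toEuclideanCLM (𝕜 := ℝ) A * toEuclideanCLM (𝕜 := ℝ) A⁻¹) w = w
    rw [← map_mul, mul_nonsing_inv _ ((isUnit_iff_isUnit_det A).1 hA), map_one]
    rfl
  have h1 := h (toEuclideanCLM (𝕜 := ℝ) A⁻¹ w)
  rw [hw] at h1
  have h2 := real_inner_le_norm (toEuclideanCLM (𝕜 := ℝ) A⁻¹ w) w
  rw [inv_mul_eq_div, le_div_iff₀' ha]
  by_contra! hlt
  have : 0 < ‖toEuclideanCLM (𝕜 := ℝ) A⁻¹ w‖ := by
    by_contra! h0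
    nlinarith [norm_nonneg w]
  nlinarith

theorem norm_neg_inv_mul_sub_le {A A' B B' : Matrix n n ℝ} {a b δ δ' : ℝ} (ha : 0 < a)
    (hA : ∀ u, a * ‖u‖ ^ 2 ≤ ⟪u, toEuclideanCLM (𝕜 := ℝ) A u⟫)
    (hA' : ∀ u, a * ‖u‖ ^ 2 ≤ ⟪u, toEuclideanCLM (𝕜 := ℝ) A' u⟫)
    (hB : ‖B‖ ≤ b) (hBB : ‖B' - B‖ ≤ δ) (hAA : ‖A' - A‖ ≤ δ') :
    ‖-(A'⁻¹ * B') - -(A⁻¹ * B)‖ ≤ a⁻¹ * (δ + δ' * (a⁻¹ * b)) := by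
  have h1 : A * A⁻¹ = 1 :=
    mul_nonsing_inv _ ((isUnit_iff_isUnit_det A).1 (isUnit_of_coercive ha hA))
  have h2 : A'⁻¹ * A' = 1 :=
    nonsing_inv_mul _ ((isUnit_iff_isUnit_det A').1 (isUnit_of_coercive ha hA'))
  have e : -(A'⁻¹ * B') - -(A⁻¹ * B) = -(A'⁻¹ * ((B' - B) - (A' - A) * (A⁻¹ * B))) := by
    have e1 : A'⁻¹ * (A' * (A⁻¹ * B)) = A⁻¹ * B := by rw [← mul_assoc, h2, one_mul]
    have e2 : A * (A⁻¹ * B) = B := by rw [← mul_assoc, h1, one_mul]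
    rw [sub_mul, e2, mul_sub, mul_sub, mul_sub, e1]
    abel
  have hb := (norm_nonneg _).trans hB
  have hd' := (norm_nonneg _).trans hAA
  have h3 := norm_inv_le_of_coercive ha hA
  have h4 := norm_inv_le_of_coercive ha hA'
  rw [e, norm_neg]
  calc _ ≤ ‖A'⁻¹‖ * (‖B' - B‖ + ‖A' - A‖ * (‖A⁻¹‖ * ‖B‖)) := by
        refine (norm_mul_le _ _).trans (mul_le_mul_of_nonneg_left ?_ (norm_nonneg _))
        refine (norm_sub_le _ _).trans (add_le_add le_rfl ?_)
        exact (norm_mul_le _ _).trans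
          (mul_le_mul_of_nonneg_left (norm_mul_le _ _) (norm_nonneg _))
    _ ≤ _ := by gcongr

end Matrices

section DecayForm

variable {ι β : Type} [DecidableEq ι] [DecidableEq β] {p : ℕ}

/-- Assumption A for an operator on sequences over a general index set, located in `ℤ` by `e`. -/
structure DecayForm (e : ι → ℤ) (K κ lamInf lamSup : ℝ) (C : HpI ι p →L[ℝ] HpI ι p) : Prop where
  symm : ∀ x y, ⟪C x, y⟫ = ⟪x, C y⟫
  lower : ∀ v, lamInf * ‖v‖ ^ 2 ≤ ⟪v, C v⟫
  upper : ∀ v, ⟪v, C v⟫ ≤ lamSup * ‖v‖ ^ 2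
  decay : ∀ t τ, t ≠ τ → specNorm (blk C t τ) ≤ K * gu ((e t : ℝ) - (e τ : ℝ)) ^ (-κ)

theorem AssumptionA.decayForm {K κ lamInf lamSup : ℝ} {C : Hp p →L[ℝ] Hp p}
    (h : AssumptionA p K κ lamInf lamSup C) : DecayForm id K κ lamInf lamSup C :=
  ⟨h.symm, h.lower, h.upper, h.decay⟩

namespace DecayForm

variable {e : ι → ℤ} {K κ lamInf lamSup : ℝ} {C D : HpI ι p →L[ℝ] HpI ι p}

theorem compression (h : DecayForm e K κ lamInf lamSup C) {f : β → ι} (hf : Function.Injective f)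
    {Y : HpI β p →L[ℝ] HpI β p} (hY : ∀ t τ, blk Y t τ = blk C (f t) (f τ)) :
    DecayForm (e ∘ f) K κ lamInf lamSup Y := by
  have hq : ∀ x y, ⟪x, Y y⟫ = ⟪embL p f hf x, C (embL p f hf y)⟫ := by
    intro x y
    rw [eq_compression hf hY, inner_embL_left]
    rfl
  refine ⟨fun x y => ?_, fun v => ?_, fun v => ?_, fun t τ hne => ?_⟩
  · rw [real_inner_comm, hq, hq, ← h.symm, real_inner_comm]
  · rw [hq, ← norm_embL hf]
    exact h.lower _
  · rw [hq, ← norm_embL hf]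
    exact h.upper _
  · rw [hY]
    exact h.decay _ _ (hf.ne hne)

theorem norm_le (h : DecayForm e K κ lamInf lamSup C) (hInf : 0 < lamInf)
    (hle : lamInf ≤ lamSup) : ‖C‖ ≤ lamSup :=
  opNorm_le_of_abs_form_le C (hInf.le.trans hle) h.symm fun x => by
    rw [abs_of_nonneg ((by positivity : 0 ≤ lamInf * ‖x‖ ^ 2).trans (h.lower x))]
    exact h.upper x

theorem norm_one_sub_le (h : DecayForm e K κ lamInf lamSup C) (hInf : 0 < lamInf)
    (hle : lamInf ≤ lamSup) : ‖1 - lamSup⁻¹ • C‖ ≤ 1 - lamInf / lamSup := by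
  have hSup : 0 < lamSup := hInf.trans_le hle
  have hq : 0 ≤ 1 - lamInf / lamSup := sub_nonneg.2 ((div_le_one hSup).2 hle)
  refine opNorm_le_of_abs_form_le _ hq (fun x y => ?_) fun x => ?_
  · simp only [_root_.sub_apply, smul_apply, one_apply_eq_self, inner_sub_left, inner_sub_right,
      real_inner_smul_left, real_inner_smul_right, h.symm]
  · have e1 : ⟪x, (1 - lamSup⁻¹ • C) x⟫ = ‖x‖ ^ 2 - ⟪x, C x⟫ / lamSup := by
      simp only [_root_.sub_apply, smul_apply, one_apply_eq_self, inner_sub_right,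
        real_inner_smul_right, real_inner_self_eq_norm_sq]
      ring
    have h1 : lamInf / lamSup * ‖x‖ ^ 2 ≤ ⟪x, C x⟫ / lamSup := by
      rw [div_mul_eq_mul_div]
      exact div_le_div_of_nonneg_right (h.lower x) hSup.le
    have h2 : ⟪x, C x⟫ / lamSup ≤ ‖x‖ ^ 2 := by
      rw [div_le_iff₀' hSup]
      exact h.upper x
    rw [e1, abs_of_nonneg (by linarith)]
    linarith

theorem norm_inverse_le (h : DecayForm e K κ lamInf lamSup C) (hInf : 0 < lamInf)
    (hCD : C * D = 1) : ‖D‖ ≤ lamInf⁻¹ := by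
  refine ContinuousLinearMap.opNorm_le_bound _ (by positivity) fun x => ?_
  have hx : C (D x) = x := congrArg (· x) hCD
  have h1 := h.lower (D x)
  rw [hx] at h1
  have h2 := real_inner_le_norm (D x) x
  rw [inv_mul_eq_div, le_div_iff₀' hInf]
  rcases (norm_nonneg (D x)).eq_or_lt with h0 | h0
  · rw [← h0, mul_zero]
    exact norm_nonneg x
  · by_contra! hlt
    nlinarith

theorem inverse_coercive (h : DecayForm e K κ lamInf lamSup C) (hInf : 0 < lamInf)
    (hle : lamInf ≤ lamSup) (hCD : C * D = 1) (x : HpI ι p) :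
    lamInf / lamSup ^ 2 * ‖x‖ ^ 2 ≤ ⟪x, D x⟫ := by
  have hSup : 0 < lamSup := hInf.trans_le hle
  have hx : C (D x) = x := congrArg (· x) hCD
  have h1 := h.lower (D x)
  rw [hx, real_inner_comm] at h1
  refine le_trans ?_ h1
  have h2 := ContinuousLinearMap.le_of_opNorm_le _ (h.norm_le hInf hle) (D x)
  rw [hx] at h2
  have h3 := pow_le_pow_left₀ (norm_nonneg _) h2 2
  rw [div_mul_eq_mul_div, mul_div_assoc]
  refine mul_le_mul_of_nonneg_left ?_ hInf.le
  rw [div_le_iff₀' (by positivity), ← mul_pow]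
  exact h3

theorem polyDecay (h : DecayForm e K κ lamInf lamSup C) (he : Function.Injective e)
    (hκ : 3 / 2 < κ) :
    PolyDecay e C (κ - 3 / 2) (|K| * ∑' s : ℤ, |(s : ℝ)| ^ (-(3 / 2) : ℝ)) := by
  intro r hr A B hAB x
  have hs : Summable fun s : ℤ => |(s : ℝ)| ^ (-(3 / 2) : ℝ) :=
    Real.summable_abs_int_rpow (by norm_num)
  refine (ContinuousLinearMap.le_of_opNorm_le (projL p A * C * projL p B) ?_ x)
  have key := opNorm_le_tsum he (projL p A * C * projL p B)
    (g := fun s : ℤ => |K| * r ^ (-(κ - 3 / 2)) * |(s : ℝ)| ^ (-(3 / 2) : ℝ))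
    (fun s => by positivity) (hs.mul_left _) fun t τ u v => ?_
  · rw [tsum_mul_left] at key
    refine key.trans (le_of_eq ?_)
    ring
  have hR : 0 ≤ |K| * r ^ (-(κ - 3 / 2)) * |((e t - e τ : ℤ) : ℝ)| ^ (-(3 / 2) : ℝ) *
      (‖u‖ * ‖v‖) := by positivity
  change ⟪lp.single 2 t u, projL p A (C (projL p B (lp.single 2 τ v)))⟫ ≤ _
  rw [← inner_projL_left]
  by_cases htA : t ∈ A
  swap
  · rw [projL_single_of_notMem htA, inner_zero_left]
    exact hR
  by_cases hτB : τ ∈ B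
  swap
  · rw [projL_single_of_notMem hτB, map_zero, inner_zero_right]
    exact hR
  rw [projL_single_of_mem htA, projL_single_of_mem hτB]
  have hdist := hAB t htA τ hτB
  have hne : t ≠ τ := by
    rintro rfl
    simp only [sub_self, abs_zero] at hdist
    linarith
  have h1 : (1 : ℝ) ≤ |(e t : ℝ) - e τ| := by
    have : 1 ≤ |e t - e τ| := Int.one_le_abs (sub_ne_zero.2 (he.ne hne))
    exact_mod_cast this
  have hpos : 0 < |(e t : ℝ) - e τ| := by linarith
  refine (le_abs_self _).trans ((norm_inner_single_le C t τ u v).trans ?_)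
  refine mul_le_mul_of_nonneg_right ((h.decay t τ hne).trans ?_) (by positivity)
  rw [gu, max_eq_right h1, Int.cast_sub, mul_assoc,
    show -κ = -(κ - 3 / 2) + -(3 / 2) by ring, Real.rpow_add hpos]
  refine mul_le_mul (le_abs_self K) (mul_le_mul_of_nonneg_right ?_ (by positivity))
    (by positivity) (abs_nonneg K)
  exact Real.rpow_le_rpow_of_nonpos hr hdist (by linarith)

end DecayForm

end DecayForm

section Sections

variable {ι β : Type} {p : ℕ} {f : β → ι} {e : ι → ℤ} {α M : ℝ}

theorem PolyDecay.extend {X : HpI β p →L[ℝ] HpI β p} (hf : Function.Injective f)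
    (hX : PolyDecay (e ∘ f) X α M) (hM : 0 ≤ M) :
    PolyDecay e (embL p f hf ∘L X ∘L restrL p f hf) α M := by
  intro r hr A B hAB x
  simp only [ContinuousLinearMap.comp_apply]
  rw [restrL_projL, projL_embL, norm_embL]
  refine (hX r hr (f ⁻¹' A) (f ⁻¹' B) (fun a ha b hb => hAB _ ha _ hb) _).trans ?_
  refine mul_le_mul_of_nonneg_left ?_ (by positivity)
  simpa using ContinuousLinearMap.le_of_opNorm_le _ (norm_restrL_le hf) x

/-- The inverse of a compression differs from the compression of the inverse by a term passing
through the complement of the retained index set. -/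
theorem inverse_compression_sub {C D : HpI ι p →L[ℝ] HpI ι p} {C' D' : HpI β p →L[ℝ] HpI β p}
    (hf : Function.Injective f) (hC' : C' = restrL p f hf ∘L C ∘L embL p f hf)
    (hDC : D * C = 1) (hCD' : C' * D' = 1) (x : HpI β p) :
    embL p f hf (D' x) =
      D (embL p f hf x) + D (projL p (Set.range f)ᶜ (C (embL p f hf (D' x)))) := by
  have h1 : C' (D' x) = x := congrArg (· x) hCD'
  have h2 : D (C (embL p f hf (D' x))) = embL p f hf (D' x) :=
    congrArg (· (embL p f hf (D' x))) hDC
  rw [hC'] at h1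
  simp only [ContinuousLinearMap.comp_apply] at h1
  rw [← map_add, ← congrArg (embL p f hf) h1, embL_restrL, projL_add_projL_compl, h2]

theorem specNorm_blk_inverse_sub_le [DecidableEq ι] [DecidableEq β]
    {C D : HpI ι p →L[ℝ] HpI ι p} {C' D' : HpI β p →L[ℝ] HpI β p}
    (hf : Function.Injective f) (hC' : C' = restrL p f hf ∘L C ∘L embL p f hf)
    (hDC : D * C = 1) (hCD' : C' * D' = 1) {M' b c r r' : ℝ} (hM : 0 ≤ M) (hM' : 0 ≤ M')
    (hCdec : PolyDecay e C α M) (hDdec : PolyDecay e D α M') (hDdec' : PolyDecay (e ∘ f) D' α M')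
    (hc : ‖C‖ ≤ c) (hb : ‖D'‖ ≤ b) (hr : 0 < r) (hr' : 0 < r') {t s : β}
    (ht : ∀ i ∉ Set.range f, r ≤ |(e (f t) : ℝ) - e i|)
    (hs : ∀ i ∉ Set.range f, r' ≤ |(e i : ℝ) - e (f s)|) :
    specNorm (blk D' t s - blk D (f t) (f s)) ≤
      M' * ((M * b + c * M') * 2 ^ α) * (r ^ (-α) * r' ^ (-α)) := by
  have hb0 : 0 ≤ b := (norm_nonneg _).trans hb
  have hc0 : 0 ≤ c := (norm_nonneg _).trans hc
  set H : Set ι := (Set.range f)ᶜ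
  set W := embL p f hf ∘L D' ∘L restrL p f hf with hW
  have hWn : ‖W‖ ≤ b := by
    refine ContinuousLinearMap.opNorm_le_bound _ hb0 fun x => ?_
    simp only [hW, ContinuousLinearMap.comp_apply]
    rw [norm_embL]
    refine (ContinuousLinearMap.le_of_opNorm_le _ hb _).trans
      (mul_le_mul_of_nonneg_left ?_ hb0)
    simpa using ContinuousLinearMap.le_of_opNorm_le _ (norm_restrL_le hf) x
  have hCW := (hCdec (r' / 2) (by positivity)).mul
    (hDdec'.extend hf hM' (r' / 2) (by positivity)) (by positivity) hc hWn
  have e1 : blk D' t s - blk D (f t) (f s) =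
      blk (D' - restrL p f hf ∘L D ∘L embL p f hf) t s := by
    ext a a'
    simp only [blk, bvec, Matrix.sub_apply, Matrix.of_apply, _root_.sub_apply,
      ContinuousLinearMap.comp_apply, inner_sub_right]
    rw [← inner_embL_left, embL_single, embL_single]
  rw [e1]
  refine specNorm_blk_le (by positivity) fun u v => ?_
  have e2 : ⟪lp.single 2 t u, (D' - restrL p f hf ∘L D ∘L embL p f hf) (lp.single 2 s v)⟫ =
      ⟪(lp.single 2 (f t) u : HpI ι p),
        projL p {f t} (D (projL p H (projL p H ((C * W) (projL p {f s}
          (lp.single 2 (f s) v))))))⟫ := by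
    rw [projL_projL, ← inner_projL_left, projL_single_of_mem (Set.mem_singleton (f t)),
      projL_single_of_mem (Set.mem_singleton (f s))]
    have e3 : (C * W) (lp.single 2 (f s) v) = C (embL p f hf (D' (lp.single 2 s v))) := by
      change C (embL p f hf (D' (restrL p f hf (lp.single 2 (f s) v)))) = _
      rw [restrL_single]
    rw [e3, ← embL_single hf t, inner_embL_left, _root_.sub_apply]
    congr 1
    have e4 := congrArg (restrL p f hf)
      (inverse_compression_sub hf hC' hDC hCD' (lp.single 2 s v))
    rw [restrL_embL, map_add] at e4
    exact sub_eq_iff_eq_add'.2 e4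
  rw [e2]
  have n1 := hDdec r hr {f t} H (by rintro _ rfl i hi; exact ht i hi)
    (projL p H ((C * W) (projL p {f s} (lp.single 2 (f s) v))))
  have n2 := hCW H {f s} (by
    rintro i hi _ rfl
    rw [add_halves]
    exact hs i hi) (lp.single 2 (f s) v)
  rw [lp.norm_single (by norm_num)] at n2
  refine (real_inner_le_norm _ _).trans ?_
  rw [lp.norm_single (by norm_num)]
  refine (mul_le_mul_of_nonneg_left (n1.trans (mul_le_mul_of_nonneg_left n2 (by positivity)))
    (norm_nonneg u)).trans (le_of_eq ?_)
  have e5 : (r' / 2) ^ (-α) = 2 ^ α * r' ^ (-α) := by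
    rw [Real.div_rpow hr'.le zero_le_two, Real.rpow_neg zero_le_two, div_inv_eq_mul, mul_comm]
  rw [e5]
  ring

theorem DecayForm.blk_inverse_coercive [DecidableEq ι] {K κ lamInf lamSup : ℝ}
    {C D : HpI ι p →L[ℝ] HpI ι p} (h : DecayForm e K κ lamInf lamSup C) (hInf : 0 < lamInf)
    (hle : lamInf ≤ lamSup) (hCD : C * D = 1) (t : ι) (u : EuclideanSpace ℝ (Fin p)) :
    lamInf / lamSup ^ 2 * ‖u‖ ^ 2 ≤ ⟪u, Matrix.toEuclideanCLM (𝕜 := ℝ) (blk D t t) u⟫ := by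
  rw [inner_toEuclideanCLM_blk]
  simpa only [lp.norm_single (p := 2) (by norm_num)] using
    h.inverse_coercive hInf hle hCD (lp.single 2 t u)

theorem specNorm_blk_le_norm [DecidableEq ι] {X : HpI ι p →L[ℝ] HpI ι p} {c : ℝ} (hX : ‖X‖ ≤ c)
    (t τ : ι) : specNorm (blk X t τ) ≤ c := by
  have hc : 0 ≤ c := (norm_nonneg _).trans hX
  refine specNorm_blk_le hc fun u v => (real_inner_le_norm _ _).trans ?_
  have h1 := ContinuousLinearMap.le_of_opNorm_le _ hX (lp.single 2 τ v)
  rw [lp.norm_single (by norm_num)] at h1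
  rw [lp.norm_single (by norm_num)]
  nlinarith [mul_le_mul_of_nonneg_left h1 (norm_nonneg u)]

end Sections

theorem rpow_neg_le_zeta_rpow {x y α : ℝ} (hα : 0 ≤ α) (hy : 0 < y) (hxy : gu x ≤ y) :
    y ^ (-α) ≤ zeta x ^ α := by
  have hg : 0 < gu x := zero_lt_one.trans_le (le_max_left _ _)
  rw [Real.rpow_neg hy.le, ← Real.inv_rpow hy.le]
  refine Real.rpow_le_rpow (by positivity) ?_ hα
  rw [zeta, inv_eq_one_div]
  exact div_le_div₀ (by positivity) (le_max_left _ _) hg hxy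

/-- Theorem 2.2, bound (2.5): pointwise Baxter-type inequality. -/
theorem baxter_pointwise (K κ lamInf lamSup : ℝ)
    (hκ : 3 / 2 < κ) (hInf : 0 < lamInf) (hle : lamInf ≤ lamSup) :
    ∃ 𝒦 : ℝ, 0 < 𝒦 ∧
      ∀ (p : ℕ), 1 ≤ p → ∀ (C : Hp p →L[ℝ] Hp p), AssumptionA p K κ lamInf lamSup C →
        ∀ (T : ℤ)
          (CT DT : HpI {t : ℤ // t ≤ T} p →L[ℝ] HpI {t : ℤ // t ≤ T} p),
          (∀ t τ : {t : ℤ // t ≤ T}, blk CT t τ = blk C (t : ℤ) (τ : ℤ)) →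
          CT.comp DT = ContinuousLinearMap.id ℝ _ →
          DT.comp CT = ContinuousLinearMap.id ℝ _ →
          ∀ (d : ℕ), 1 ≤ d →
            ∀ (Cd Dd : HpI {t : ℤ // T - (d : ℤ) ≤ t ∧ t ≤ T} p →L[ℝ]
                       HpI {t : ℤ // T - (d : ℤ) ≤ t ∧ t ≤ T} p),
              (∀ t τ : {t : ℤ // T - (d : ℤ) ≤ t ∧ t ≤ T},
                blk Cd t τ = blk C (t : ℤ) (τ : ℤ)) →
              Cd.comp Dd = ContinuousLinearMap.id ℝ _ →
              Dd.comp Cd = ContinuousLinearMap.id ℝ _ →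
              ∀ (j : ℕ) (_ : 1 ≤ j) (hjd : j ≤ d),
                specNorm (PhiFin Dd j hjd - PhiInf DT j) ≤
                  𝒦 * zeta (d : ℝ) ^ (κ - 3 / 2) * zeta ((d : ℝ) - (j : ℝ)) ^ (κ - 3 / 2) := by
  have hSup : 0 < lamSup := hInf.trans_le hle
  have hα : 0 < κ - 3 / 2 := by linarith
  have hq0 : 0 ≤ 1 - lamInf / lamSup := sub_nonneg.2 ((div_le_one hSup).2 hle)
  have hq1 : 1 - lamInf / lamSup < 1 := sub_lt_self _ (div_pos hInf hSup)
  set α := κ - 3 / 2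
  set MC := |K| * ∑' s : ℤ, |(s : ℝ)| ^ (-(3 / 2) : ℝ)
  set MD := lamSup⁻¹ * (lamSup⁻¹ * MC) * neumannConst α (1 - lamInf / lamSup)
  set M := MD * ((MC * lamInf⁻¹ + lamSup * MD) * 2 ^ α)
  set a := lamInf / lamSup ^ 2
  have hMC : 0 ≤ MC := mul_nonneg (abs_nonneg K) (tsum_nonneg fun s => by positivity)
  have hMD : 0 ≤ MD :=
    mul_nonneg (by positivity) (tsum_nonneg fun n => by positivity)
  have hM : 0 ≤ M := by positivity
  have ha : 0 < a := by positivity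
  have h𝒦 : 0 ≤ a⁻¹ * (M + M * (a⁻¹ * lamInf⁻¹)) := by positivity
  refine ⟨a⁻¹ * (M + M * (a⁻¹ * lamInf⁻¹)) + 1, by positivity, ?_⟩
  intro p _ C hC T CT DT hCT hCD hDC d hd Cd Dd hCd hCDd _ j hj hjd
  let f : {t : ℤ // T - (d : ℤ) ≤ t ∧ t ≤ T} → {t : ℤ // t ≤ T} := fun t => ⟨t, t.2.2⟩
  have hf : Function.Injective f := fun s t hst =>
    Subtype.ext (congrArg (fun k : {t : ℤ // t ≤ T} => (k : ℤ)) hst)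
  have hCd' : ∀ t τ, blk Cd t τ = blk CT (f t) (f τ) := fun t τ => by rw [hCd, hCT]
  have hT := hC.decayForm.compression Subtype.val_injective hCT
  have hS := hT.compression hf hCd'
  have heT : Function.Injective (id ∘ Subtype.val : {t : ℤ // t ≤ T} → ℤ) :=
    Subtype.val_injective
  have pT := hT.polyDecay heT hκ
  have pTD := pT.inverse hMC (by positivity) (hT.norm_one_sub_le hInf hle) hq1 hCD
  have pSD := (hS.polyDecay (heT.comp hf) hκ).inverse hMC (by positivity)
    (hS.norm_one_sub_le hInf hle) hq1 hCDd
  have hd0 : (0 : ℝ) < d := by exact_mod_cast hd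
  have corner : ∀ i : ℕ, ∀ hi : i ≤ d,
      specNorm (blk Dd ⟨T, by omega⟩ ⟨T - (i : ℤ), by omega⟩ -
        blk DT ⟨T, le_refl T⟩ ⟨T - (i : ℤ), by omega⟩) ≤
        M * ((d : ℝ) ^ (-α) * ((d : ℝ) - i + 1) ^ (-α)) := by
    intro i hi
    have hi' : (i : ℝ) ≤ d := by exact_mod_cast hi
    have hout : ∀ k ∉ Set.range f, ((k : ℤ) : ℝ) ≤ T - d - 1 := by
      intro k hk
      have : (k : ℤ) ≤ T - d - 1 := by
        by_contra! hlt
        exact hk ⟨⟨k, by omega, k.2⟩, rfl⟩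
      exact_mod_cast this
    refine specNorm_blk_inverse_sub_le hf (eq_compression hf hCd') hDC hCDd hMC hMD pT pTD pSD
      (hT.norm_le hInf hle) (hS.norm_inverse_le hInf hCDd) hd0 (by linarith)
      (fun k hk => ?_) (fun k hk => ?_)
    · refine le_trans ?_ (le_abs_self _)
      have := hout k hk
      change (d : ℝ) ≤ (T : ℝ) - ((k : ℤ) : ℝ)
      linarith
    · refine le_trans ?_ (neg_le_abs _)
      have := hout k hk
      change (d : ℝ) - i + 1 ≤ -(((k : ℤ) : ℝ) - ((T - (i : ℤ) : ℤ) : ℝ))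
      push_cast
      linarith
  have hj' : (j : ℝ) ≤ d := by exact_mod_cast hjd
  set P := (d : ℝ) ^ (-α) * ((d : ℝ) - j + 1) ^ (-α)
  have hP0 : 0 ≤ P := mul_nonneg (by positivity) (Real.rpow_nonneg (by linarith) _)
  have hPz : P ≤ zeta (d : ℝ) ^ α * zeta ((d : ℝ) - (j : ℝ)) ^ α := by
    refine mul_le_mul (rpow_neg_le_zeta_rpow hα.le hd0 ?_)
      (rpow_neg_le_zeta_rpow hα.le (by linarith) ?_) (Real.rpow_nonneg (by linarith) _)
      (Real.rpow_nonneg (div_nonneg (zero_le_one.trans (le_max_left _ _))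
        (zero_le_one.trans (le_max_left _ _))) _)
    · rw [gu, abs_of_pos hd0]
      exact max_le (by exact_mod_cast hd) le_rfl
    · rw [gu, abs_of_nonneg (by linarith)]
      exact max_le (by linarith) (by linarith)
  have hdiag : specNorm (blk Dd ⟨T, by omega⟩ ⟨T, by omega⟩ -
      blk DT ⟨T, le_refl T⟩ ⟨T, le_refl T⟩) ≤ M * P := by
    have h0 := corner 0 (Nat.zero_le d)
    simp only [Nat.cast_zero, sub_zero] at h0
    refine h0.trans (mul_le_mul_of_nonneg_left
      (mul_le_mul_of_nonneg_left ?_ (by positivity)) hM)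
    exact Real.rpow_le_rpow_of_nonpos (by linarith) (by
      have : (0 : ℝ) ≤ j := Nat.cast_nonneg j
      linarith) (by linarith)
  have main : specNorm (PhiFin Dd j hjd - PhiInf DT j) ≤
      a⁻¹ * (M * P + M * P * (a⁻¹ * lamInf⁻¹)) :=
    norm_neg_inv_mul_sub_le ha (hT.blk_inverse_coercive hInf hle hCD _)
      (hS.blk_inverse_coercive hInf hle hCDd _)
      (specNorm_blk_le_norm (hT.norm_inverse_le hInf hCD) _ _) (corner j hjd) hdiag
  calc specNorm (PhiFin Dd j hjd - PhiInf DT j)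
      ≤ (a⁻¹ * (M + M * (a⁻¹ * lamInf⁻¹))) * P := main.trans (le_of_eq (by ring))
    _ ≤ (a⁻¹ * (M + M * (a⁻¹ * lamInf⁻¹)) + 1) * P :=
        mul_le_mul_of_nonneg_right (by linarith) hP0
    _ ≤ (a⁻¹ * (M + M * (a⁻¹ * lamInf⁻¹)) + 1) *
          (zeta (d : ℝ) ^ α * zeta ((d : ℝ) - (j : ℝ)) ^ α) :=
        mul_le_mul_of_nonneg_left hPz (by linarith)
    _ = _ := (mul_assoc _ _ _).symm
end
end

section
/- Baxter-type inequality, summed bound (Theorem 2.2, bound (2.6)). Fix constants K < ∞, κ > 5/2 and 0 < λ_inf ≤ λ_sup < ∞. Then there exists a constant 𝒦 < ∞, depending only on K, κ, λ_inf, λ_sup, such that for every p ∈ ℕ, every operator 𝐂 satisfying Assumption A(p, K, κ, λ_inf, λ_sup), every T ∈ ℤ and every d ∈ ℕ: Σ_{j=1}^{d} ‖Φ_{T,d,j} − Φ_{T,j}‖₂ ≤ 𝒦 ζ(d)^{κ−3/2}. -/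
noncomputable section

section SpectralNorm

open scoped Matrix.Norms.L2Operator

theorem specNorm_nonneg {p : ℕ} (M : Matrix (Fin p) (Fin p) ℝ) : 0 ≤ specNorm M := norm_nonneg _

theorem specNorm_neg {p : ℕ} (M : Matrix (Fin p) (Fin p) ℝ) : specNorm (-M) = specNorm M :=
  norm_neg M

theorem specNorm_sub_le {p : ℕ} (M N : Matrix (Fin p) (Fin p) ℝ) :
    specNorm (M - N) ≤ specNorm M + specNorm N := norm_sub_le M N

theorem specNorm_mul_le {p : ℕ} (M N : Matrix (Fin p) (Fin p) ℝ) :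
    specNorm (M * N) ≤ specNorm M * specNorm N := Matrix.l2_opNorm_mul M N

theorem specNorm_le_of_forall {p : ℕ} {M : Matrix (Fin p) (Fin p) ℝ} {c : ℝ} (hc : 0 ≤ c)
    (h : ∀ u, ‖Matrix.toEuclideanLin M u‖ ≤ c * ‖u‖) : specNorm M ≤ c :=
  ContinuousLinearMap.opNorm_le_bound _ hc h

theorem norm_toEuclideanLin_le {p : ℕ} (M : Matrix (Fin p) (Fin p) ℝ)
    (u : EuclideanSpace ℝ (Fin p)) : ‖Matrix.toEuclideanLin M u‖ ≤ specNorm M * ‖u‖ :=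
  (LinearMap.toContinuousLinearMap (Matrix.toEuclideanLin M)).le_opNorm u

/-- A coercive matrix is invertible, with inverse bounded by the reciprocal constant. -/
theorem coercive_isUnit_det_and_specNorm_inv_le {p : ℕ} {M : Matrix (Fin p) (Fin p) ℝ} {b : ℝ}
    (hb : 0 < b) (h : ∀ u, ‖u‖ ^ 2 ≤ b * inner ℝ u (Matrix.toEuclideanLin M u)) :
    IsUnit M.det ∧ specNorm M⁻¹ ≤ b := by
  have hbound : ∀ u, ‖u‖ ≤ b * ‖Matrix.toEuclideanLin M u‖ := by
    intro u
    rcases (norm_nonneg u).eq_or_lt with h0 | h0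
    · rw [← h0]; positivity
    · have h1 := h u
      have h2 := real_inner_le_norm u (Matrix.toEuclideanLin M u)
      have h3 : ‖u‖ * ‖u‖ ≤ ‖u‖ * (b * ‖Matrix.toEuclideanLin M u‖) := by nlinarith
      exact le_of_mul_le_mul_left h3 h0
  have hdet : IsUnit M.det := by
    rw [isUnit_iff_ne_zero]
    intro h0
    obtain ⟨v, hv, hMv⟩ := Matrix.exists_mulVec_eq_zero_iff.mpr h0
    have h1 := hbound (WithLp.toLp 2 v)
    rw [Matrix.toLpLin_apply] at h1
    simp only [hMv, WithLp.toLp_zero, norm_zero, mul_zero] at h1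
    have h2 := norm_le_zero_iff.mp h1
    exact hv (by simpa using h2)
  refine ⟨hdet, specNorm_le_of_forall hb.le fun u => ?_⟩
  have h1 := hbound (Matrix.toEuclideanLin M⁻¹ u)
  have h2 : Matrix.toEuclideanLin M (Matrix.toEuclideanLin M⁻¹ u) = u := by
    rw [Matrix.toLpLin_apply, Matrix.toLpLin_apply]
    simp [Matrix.mulVec_mulVec, Matrix.mul_nonsing_inv _ hdet]
  rwa [h2] at h1

end SpectralNorm

section Blocks

variable {ι : Type} [DecidableEq ι] {p : ℕ}

theorem apply_single_eq (A : HpI ι p →L[ℝ] HpI ι p) (t τ : ι) (u : EuclideanSpace ℝ (Fin p)) :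
    A (lp.single 2 τ u) t = Matrix.toEuclideanLin (blk A t τ) u := by
  let L : EuclideanSpace ℝ (Fin p) →ₗ[ℝ] EuclideanSpace ℝ (Fin p) :=
    { toFun := fun u => A (lp.single 2 τ u) t
      map_add' := fun x y => by simp
      map_smul' := fun c x => by simp }
  suffices L = Matrix.toEuclideanLin (blk A t τ) from LinearMap.congr_fun this u
  refine (EuclideanSpace.basisFun (Fin p) ℝ).toBasis.ext fun b => ?_
  ext a
  simp [L, Matrix.toLpLin_apply, blk, bvec, lp.inner_single_left, EuclideanSpace.inner_single_left,
    Matrix.mulVec_single]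

theorem norm_apply_single_le (A : HpI ι p →L[ℝ] HpI ι p) (t τ : ι)
    (u : EuclideanSpace ℝ (Fin p)) :
    ‖A (lp.single 2 τ u) t‖ ≤ specNorm (blk A t τ) * ‖u‖ := by
  rw [apply_single_eq]; exact norm_toEuclideanLin_le _ _

theorem hasSum_lp_single (v : HpI ι p) : HasSum (fun i => lp.single 2 i (v i) : ι → HpI ι p) v :=
  lp.hasSum_single (by simp) v

theorem inner_single_eq (i : ι) (u : EuclideanSpace ℝ (Fin p)) (v : HpI ι p) :
    inner ℝ (lp.single 2 i u : HpI ι p) v = inner ℝ u (v i) :=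
  lp.inner_single_left i u v

theorem norm_single_eq (i : ι) (u : EuclideanSpace ℝ (Fin p)) :
    ‖(lp.single 2 i u : HpI ι p)‖ = ‖u‖ := by
  apply lp.norm_single
  norm_num

theorem hasSum_clm_apply (A : HpI ι p →L[ℝ] HpI ι p) (v : HpI ι p) (t : ι) :
    HasSum (fun i => A (lp.single 2 i (v i)) t) (A v t) :=
  ((hasSum_lp_single v).mapL A).mapL (lp.evalCLM ℝ (fun _ : ι => EuclideanSpace ℝ (Fin p)) 2 t)

end Blocks

section Extension

variable {ι ι' : Type} [DecidableEq ι] [DecidableEq ι'] {p : ℕ}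

theorem apply_eq_of_inner_single {v : HpI ι p} {w : HpI ι' p} {i : ι} {j : ι'}
    (h : ∀ x : EuclideanSpace ℝ (Fin p),
      inner ℝ (lp.single 2 i x : HpI ι p) v = inner ℝ (lp.single 2 j x : HpI ι' p) w) :
    v i = w j :=
  ext_inner_left ℝ fun x =>
    (inner_single_eq i x v).symm.trans ((h x).trans (inner_single_eq j x w))

/-- The inclusion of the `i`-th coordinate space, as a linear isometry. -/
def singleIsometry (p : ℕ) (i : ι) : EuclideanSpace ℝ (Fin p) →ₗᵢ[ℝ] HpI ι p where
  toLinearMap :=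
    (lp.singleContinuousLinearMap ℝ (fun _ : ι => EuclideanSpace ℝ (Fin p)) 2 i).toLinearMap
  norm_map' u := by
    have h := norm_single_eq i u
    exact h

theorem singleIsometry_apply (i : ι) (u : EuclideanSpace ℝ (Fin p)) :
    singleIsometry p i u = lp.single 2 i u := rfl

theorem orthogonalFamily_single_comp {α : Type} {e : α → ι'} (he : Function.Injective e) :
    OrthogonalFamily ℝ (fun _ : α => EuclideanSpace ℝ (Fin p))
      (fun i => singleIsometry p (e i)) := by
  intro i j hij v w
  rw [singleIsometry_apply, singleIsometry_apply, inner_single_eq,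
    lp.single_apply_ne _ _ _ (he.ne hij)]
  exact inner_zero_right _

/-- Extension by zero along an injective map of index sets. -/
def extendZero (p : ℕ) {e : ι → ι'} (he : Function.Injective e) : HpI ι p →ₗᵢ[ℝ] HpI ι' p :=
  (orthogonalFamily_single_comp he).linearIsometry

theorem extendZero_single {e : ι → ι'} (he : Function.Injective e) (i : ι)
    (u : EuclideanSpace ℝ (Fin p)) :
    extendZero p he (lp.single 2 i u) = lp.single 2 (e i) u :=
  (orthogonalFamily_single_comp he).linearIsometry_apply_single u

theorem inner_blk_congr {e : ι → ι'} (he : Function.Injective e)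
    {A : HpI ι p →L[ℝ] HpI ι p} {A' : HpI ι' p →L[ℝ] HpI ι' p}
    (h : ∀ t τ, blk A t τ = blk A' (e t) (e τ)) (v w : HpI ι p) :
    inner ℝ (extendZero p he v) (A' (extendZero p he w)) = inner ℝ v (A w) := by
  let J := (extendZero p he).toContinuousLinearMap
  suffices H : (J.adjoint.comp (A'.comp J)) = A by
    rw [← H]
    exact (ContinuousLinearMap.adjoint_inner_right J _ _).symm
  refine lp.ext_continuousLinearMap (by simp) fun τ => ?_
  ext1 u
  refine lp.ext (funext fun t => apply_eq_of_inner_single fun x => ?_)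
  change inner ℝ (lp.single 2 t x : HpI ι p) (J.adjoint (A' (J (lp.single 2 τ u)))) =
    inner ℝ (lp.single 2 t x : HpI ι p) (A (lp.single 2 τ u))
  rw [ContinuousLinearMap.adjoint_inner_right]
  change inner ℝ (extendZero p he (lp.single 2 t x)) (A' (extendZero p he (lp.single 2 τ u))) = _
  rw [extendZero_single, extendZero_single, inner_single_eq, inner_single_eq,
    apply_single_eq, apply_single_eq, h]

theorem extendZero_apply {e : ι → ι'} (he : Function.Injective e) (v : HpI ι p) (i : ι) :
    extendZero p he v (e i) = v i := by
  refine apply_eq_of_inner_single fun x => ?_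
  rw [← extendZero_single he,
    LinearIsometry.inner_map_map]

theorem compression_apply {e : ι → ι'} (he : Function.Injective e)
    {A : HpI ι p →L[ℝ] HpI ι p} {A' : HpI ι' p →L[ℝ] HpI ι' p}
    (h : ∀ t τ, blk A t τ = blk A' (e t) (e τ)) (v : HpI ι p) (i : ι) :
    A' (extendZero p he v) (e i) = A v i := by
  refine apply_eq_of_inner_single fun x => ?_
  rw [← extendZero_single he,
    inner_blk_congr he h]

end Extension

section Weights

theorem one_le_gu (x : ℝ) : 1 ≤ gu x := le_max_left _ _

theorem gu_pos (x : ℝ) : 0 < gu x := one_pos.trans_le (one_le_gu x)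

theorem abs_le_gu (x : ℝ) : |x| ≤ gu x := le_max_right _ _

theorem gu_sub_comm (x y : ℝ) : gu (x - y) = gu (y - x) := by
  rw [gu, gu, abs_sub_comm]

theorem gu_rpow_nonneg (x s : ℝ) : 0 ≤ gu x ^ s := Real.rpow_nonneg (gu_pos x).le s

theorem summable_gu_rpow {s : ℝ} (hs : 1 < s) : Summable fun n : ℤ => gu (n : ℝ) ^ (-s) := by
  refine (summable_congr_cofinite ?_).mpr (Real.summable_abs_int_rpow hs)
  filter_upwards [(Set.finite_singleton (0 : ℤ)).compl_mem_cofinite] with n hn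
  have h : (1 : ℝ) ≤ |(n : ℝ)| := by exact_mod_cast Int.one_le_abs hn
  rw [gu, max_eq_right h]

/-- The sum of `⟨n⟩ ^ (-s)` over the integers. -/
def guSum (s : ℝ) : ℝ := ∑' n : ℤ, gu (n : ℝ) ^ (-s)

theorem guSum_nonneg (s : ℝ) : 0 ≤ guSum s := tsum_nonneg fun _ => gu_rpow_nonneg _ _

theorem sum_gu_rpow_le {ι : Type} {e : ι → ℤ} (he : Function.Injective e) {s : ℝ} (hs : 1 < s)
    (m : ℤ) (F : Finset ι) : ∑ i ∈ F, gu ((e i : ℝ) - m) ^ (-s) ≤ guSum s := by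
  have hinj : Function.Injective fun i => e i - m := fun i j h => he (by simpa using h)
  have h := (summable_gu_rpow hs).sum_le_tsum (F.map ⟨_, hinj⟩) fun _ _ => gu_rpow_nonneg _ _
  simpa [guSum] using h

theorem sum_gu_rpow_le' {ι : Type} {e : ι → ℤ} (he : Function.Injective e) {s : ℝ} (hs : 1 < s)
    (m : ℤ) (F : Finset ι) : ∑ i ∈ F, gu ((m : ℝ) - e i) ^ (-s) ≤ guSum s := by
  simpa only [gu_sub_comm] using sum_gu_rpow_le he hs m F

/-- Far from the origin, part of the decay of `⟨x⟩ ^ (-κ)` can be traded for a factor that is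
uniformly small, keeping a summable remainder. -/
theorem gu_rpow_le_mul {κ N x : ℝ} (hκ : 3 / 2 ≤ κ) (hN : 0 < N) (hx : N ≤ gu x) :
    gu x ^ (-κ) ≤ N ^ (-(κ - 3 / 2)) * gu x ^ (-(3 / 2 : ℝ)) := by
  have h : gu x ^ (-κ) = gu x ^ (-(κ - 3 / 2)) * gu x ^ (-(3 / 2 : ℝ)) := by
    rw [← Real.rpow_add (gu_pos x)]; congr 1; ring
  rw [h]
  gcongr ?_ * _
  · exact gu_rpow_nonneg _ _
  · exact Real.rpow_le_rpow_of_nonpos hN hx (by linarith)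

end Weights

/-- A self-adjoint operator on `ℓ²(ι; ℝ^p)`, with `ι` embedded in the integers, whose quadratic
form is bounded between `a` and `b` and whose blocks decay polynomially off the diagonal. -/
structure IsDecayingForm {ι : Type} [DecidableEq ι] {p : ℕ} (e : ι → ℤ) (K κ a b : ℝ)
    (A : HpI ι p →L[ℝ] HpI ι p) : Prop where
  inj : Function.Injective e
  symm : ∀ x y : HpI ι p, inner ℝ (A x) y = inner ℝ x (A y)
  lower : ∀ v : HpI ι p, a * ‖v‖ ^ 2 ≤ inner ℝ v (A v)
  upper : ∀ v : HpI ι p, inner ℝ v (A v) ≤ b * ‖v‖ ^ 2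
  decay : ∀ t τ : ι, t ≠ τ → specNorm (blk A t τ) ≤ K * gu ((e t : ℝ) - e τ) ^ (-κ)

theorem AssumptionA.isDecayingForm_compression {ι : Type} [DecidableEq ι] {p : ℕ}
    {K κ a b : ℝ} {C : Hp p →L[ℝ] Hp p} (hC : AssumptionA p K κ a b C) {e : ι → ℤ}
    (he : Function.Injective e) {A : HpI ι p →L[ℝ] HpI ι p}
    (h : ∀ t τ, blk A t τ = blk C (e t) (e τ)) : IsDecayingForm e |K| κ a b A where
  inj := he
  symm x y := by
    rw [← inner_blk_congr he h, real_inner_comm, ← inner_blk_congr he h, ← hC.symm,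
      real_inner_comm]
  lower v := by
    rw [← inner_blk_congr he h, ← (extendZero p he).norm_map v]
    exact hC.lower _
  upper v := by
    rw [← inner_blk_congr he h, ← (extendZero p he).norm_map v]
    exact hC.upper _
  decay t τ htτ := by
    rw [h]
    refine (hC.decay _ _ (he.ne htτ)).trans ?_
    gcongr
    · exact gu_rpow_nonneg _ _
    · exact le_abs_self K

section Cutoff

variable {ι : Type} {p : ℕ}

/-- Restriction of a sequence to a set of indices. -/
def cutoff (E : Set ι) (v : HpI ι p) : HpI ι p :=
  ⟨fun i => E.indicator (fun j => v j) i,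
    (lp.memℓp v).norm.mono fun _ => norm_indicator_le_norm_self _ _⟩

theorem cutoff_apply_of_mem {E : Set ι} (v : HpI ι p) {i : ι} (h : i ∈ E) :
    cutoff E v i = v i := Set.indicator_of_mem h _

theorem cutoff_apply_of_notMem {E : Set ι} (v : HpI ι p) {i : ι} (h : i ∉ E) :
    cutoff E v i = 0 := Set.indicator_of_notMem h _

theorem norm_cutoff_le (E : Set ι) (v : HpI ι p) : ‖cutoff E v‖ ≤ ‖v‖ := by
  exact lp.norm_mono (by simp) fun _ => norm_indicator_le_norm_self _ _

theorem cutoff_add_cutoff_compl (E : Set ι) (v : HpI ι p) :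
    cutoff E v + cutoff Eᶜ v = v := by
  refine lp.ext (funext fun i => ?_)
  change E.indicator (fun j => v j) i + Eᶜ.indicator (fun j => v j) i = v i
  exact Set.indicator_self_add_compl_apply E _ i

theorem inner_cutoff_left (E : Set ι) (v w : HpI ι p)
    (h : ∀ i ∈ E, w i = 0) : inner ℝ (cutoff E v) w = 0 := by
  rw [lp.inner_eq_tsum]
  refine (tsum_congr fun i => ?_).trans tsum_zero
  by_cases hi : i ∈ E
  · rw [h i hi]; exact inner_zero_right _
  · rw [cutoff_apply_of_notMem v hi]; exact inner_zero_left _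

theorem inner_cutoff_self (E : Set ι) (v : HpI ι p) :
    inner ℝ (cutoff E v) v = ‖cutoff E v‖ ^ 2 := by
  have h : inner ℝ (cutoff E v) (cutoff Eᶜ v) = 0 :=
    inner_cutoff_left E v _ fun i hi => cutoff_apply_of_notMem v (by simpa using hi)
  calc inner ℝ (cutoff E v) v = inner ℝ (cutoff E v) (cutoff E v + cutoff Eᶜ v) := by
        rw [cutoff_add_cutoff_compl]
    _ = _ := by rw [inner_add_right, h, add_zero, real_inner_self_eq_norm_sq]

end Cutoff

section WeightedSums

variable {ι : Type} {p : ℕ} {e : ι → ℤ}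

theorem sum_norm_sq_le (v : HpI ι p) (F : Finset ι) : ∑ t ∈ F, ‖v t‖ ^ 2 ≤ ‖v‖ ^ 2 := by
  have h := lp.sum_rpow_le_norm_rpow (p := 2) (by simp) v F
  simpa using h

theorem sum_weight_mul_le {s : ℝ} (he : Function.Injective e) (hs : 1 < s) (w v : HpI ι p)
    (F : Finset ι) :
    ∑ t ∈ F, ∑ τ ∈ F, gu ((e t : ℝ) - e τ) ^ (-s) * (‖v‖ * ‖w t‖ * (‖w‖ * ‖v τ‖)) ≤
      guSum s * (‖w‖ * ‖v‖) ^ 2 := by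
  have h1 : ∑ t ∈ F, ∑ τ ∈ F, gu ((e t : ℝ) - e τ) ^ (-s) * (‖v‖ * ‖w t‖) ^ 2 ≤
      guSum s * (‖w‖ * ‖v‖) ^ 2 := by
    calc _ ≤ ∑ t ∈ F, guSum s * (‖v‖ * ‖w t‖) ^ 2 := by
          refine Finset.sum_le_sum fun t _ => ?_
          rw [← Finset.sum_mul]
          gcongr
          exact sum_gu_rpow_le' he hs _ F
      _ = guSum s * (‖v‖ ^ 2 * ∑ t ∈ F, ‖w t‖ ^ 2) := by
          simp only [mul_pow, Finset.mul_sum]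
      _ ≤ guSum s * (‖v‖ ^ 2 * ‖w‖ ^ 2) := by
          gcongr
          · exact guSum_nonneg s
          · exact sum_norm_sq_le w F
      _ = _ := by ring
  have h2 : ∑ t ∈ F, ∑ τ ∈ F, gu ((e t : ℝ) - e τ) ^ (-s) * (‖w‖ * ‖v τ‖) ^ 2 ≤
      guSum s * (‖w‖ * ‖v‖) ^ 2 := by
    rw [Finset.sum_comm]
    calc _ ≤ ∑ τ ∈ F, guSum s * (‖w‖ * ‖v τ‖) ^ 2 := by
          refine Finset.sum_le_sum fun τ _ => ?_
          rw [← Finset.sum_mul]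
          gcongr
          exact sum_gu_rpow_le he hs _ F
      _ = guSum s * (‖w‖ ^ 2 * ∑ τ ∈ F, ‖v τ‖ ^ 2) := by
          simp only [mul_pow, Finset.mul_sum]
      _ ≤ guSum s * (‖w‖ ^ 2 * ‖v‖ ^ 2) := by
          gcongr
          · exact guSum_nonneg s
          · exact sum_norm_sq_le v F
      _ = _ := by ring
  have h3 : ∑ t ∈ F, ∑ τ ∈ F, gu ((e t : ℝ) - e τ) ^ (-s) * (‖v‖ * ‖w t‖ * (‖w‖ * ‖v τ‖)) ≤
      ((∑ t ∈ F, ∑ τ ∈ F, gu ((e t : ℝ) - e τ) ^ (-s) * (‖v‖ * ‖w t‖) ^ 2) +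
        ∑ t ∈ F, ∑ τ ∈ F, gu ((e t : ℝ) - e τ) ^ (-s) * (‖w‖ * ‖v τ‖) ^ 2) / 2 := by
    rw [← Finset.sum_add_distrib, Finset.sum_div]
    refine Finset.sum_le_sum fun t _ => ?_
    rw [← Finset.sum_add_distrib, Finset.sum_div]
    refine Finset.sum_le_sum fun τ _ => ?_
    rw [← mul_add, mul_div_assoc]
    gcongr
    · exact gu_rpow_nonneg _ _
    · nlinarith [sq_nonneg (‖v‖ * ‖w t‖ - ‖w‖ * ‖v τ‖)]
  linarith

end WeightedSums

namespace IsDecayingForm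

variable {ι : Type} [DecidableEq ι] {p : ℕ} {e : ι → ℤ} {K κ a b : ℝ}
  {A : HpI ι p →L[ℝ] HpI ι p}

theorem abs_inner_apply_sum_single_le (A : HpI ι p →L[ℝ] HpI ι p) (w v : HpI ι p)
    (F : Finset ι) :
    |inner ℝ (∑ t ∈ F, lp.single 2 t (w t) : HpI ι p) (A (∑ τ ∈ F, lp.single 2 τ (v τ)))| ≤
      ∑ t ∈ F, ∑ τ ∈ F, specNorm (blk A t τ) * (‖w t‖ * ‖v τ‖) := by
  rw [map_sum, sum_inner]
  refine (Finset.abs_sum_le_sum_abs _ _).trans (Finset.sum_le_sum fun t _ => ?_)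
  rw [inner_sum]
  refine (Finset.abs_sum_le_sum_abs _ _).trans (Finset.sum_le_sum fun τ _ => ?_)
  rw [inner_single_eq]
  refine (abs_real_inner_le_norm _ _).trans ?_
  calc ‖w t‖ * ‖A (lp.single 2 τ (v τ)) t‖ ≤ ‖w t‖ * (specNorm (blk A t τ) * ‖v τ‖) := by
        gcongr; exact norm_apply_single_le A t τ (v τ)
    _ = _ := by ring

/-- The operator nearly decouples sequences whose supports are at distance at least `N`. -/
theorem abs_inner_le_of_separated (hA : IsDecayingForm e K κ a b A) (hK : 0 ≤ K)
    (hκ : 3 / 2 ≤ κ) {N : ℝ} (hN : 0 < N) {w v : HpI ι p}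
    (hsep : ∀ t τ, w t ≠ 0 → v τ ≠ 0 → N ≤ |(e t : ℝ) - e τ|) :
    |inner ℝ w (A v)| ≤ K * guSum (3 / 2) * N ^ (-(κ - 3 / 2)) * ‖w‖ * ‖v‖ := by
  rcases (norm_nonneg w).eq_or_lt with hw | hw
  · rw [norm_eq_zero.mp hw.symm]; simp
  rcases (norm_nonneg v).eq_or_lt with hv | hv
  · rw [norm_eq_zero.mp hv.symm]; simp
  have hpos : 0 < ‖w‖ * ‖v‖ := mul_pos hw hv
  have hNs : 0 ≤ N ^ (-(κ - 3 / 2)) := Real.rpow_nonneg hN.le _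
  suffices H : ∀ F : Finset ι,
      |inner ℝ (∑ t ∈ F, lp.single 2 t (w t) : HpI ι p) (A (∑ τ ∈ F, lp.single 2 τ (v τ)))| ≤
        K * guSum (3 / 2) * N ^ (-(κ - 3 / 2)) * ‖w‖ * ‖v‖ from
    le_of_tendsto' ((Filter.Tendsto.inner (hasSum_lp_single w)
      ((A.continuous.tendsto v).comp (hasSum_lp_single v))).abs) H
  intro F
  refine (abs_inner_apply_sum_single_le A w v F).trans ?_
  have hterm : ∀ t τ, (‖w‖ * ‖v‖) * (specNorm (blk A t τ) * (‖w t‖ * ‖v τ‖)) ≤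
      K * N ^ (-(κ - 3 / 2)) *
        (gu ((e t : ℝ) - e τ) ^ (-(3 / 2 : ℝ)) * (‖v‖ * ‖w t‖ * (‖w‖ * ‖v τ‖))) := by
    intro t τ
    by_cases hwt : w t = 0
    · simp [hwt]
    by_cases hvτ : v τ = 0
    · simp [hvτ]
    have hd := hsep t τ hwt hvτ
    have hne : t ≠ τ := by
      rintro rfl
      simp only [sub_self, abs_zero] at hd
      linarith
    have h1 : specNorm (blk A t τ) ≤
        K * (N ^ (-(κ - 3 / 2)) * gu ((e t : ℝ) - e τ) ^ (-(3 / 2 : ℝ))) :=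
      (hA.decay t τ hne).trans (by
        gcongr
        exact gu_rpow_le_mul hκ hN (hd.trans (abs_le_gu _)))
    calc (‖w‖ * ‖v‖) * (specNorm (blk A t τ) * (‖w t‖ * ‖v τ‖))
        ≤ (‖w‖ * ‖v‖) * (K * (N ^ (-(κ - 3 / 2)) * gu ((e t : ℝ) - e τ) ^ (-(3 / 2 : ℝ))) *
          (‖w t‖ * ‖v τ‖)) := by gcongr
      _ = _ := by ring
  have hsum : (‖w‖ * ‖v‖) * ∑ t ∈ F, ∑ τ ∈ F, specNorm (blk A t τ) * (‖w t‖ * ‖v τ‖) ≤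
      (‖w‖ * ‖v‖) * (K * guSum (3 / 2) * N ^ (-(κ - 3 / 2)) * ‖w‖ * ‖v‖) := by
    calc _ ≤ ∑ t ∈ F, ∑ τ ∈ F, K * N ^ (-(κ - 3 / 2)) *
          (gu ((e t : ℝ) - e τ) ^ (-(3 / 2 : ℝ)) * (‖v‖ * ‖w t‖ * (‖w‖ * ‖v τ‖))) := by
          simp only [Finset.mul_sum]
          exact Finset.sum_le_sum fun t _ => Finset.sum_le_sum fun τ _ => hterm t τ
      _ = K * N ^ (-(κ - 3 / 2)) * ∑ t ∈ F, ∑ τ ∈ F,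
          (gu ((e t : ℝ) - e τ) ^ (-(3 / 2 : ℝ)) * (‖v‖ * ‖w t‖ * (‖w‖ * ‖v τ‖))) := by
          simp only [Finset.mul_sum]
      _ ≤ K * N ^ (-(κ - 3 / 2)) * (guSum (3 / 2) * (‖w‖ * ‖v‖) ^ 2) := by
          gcongr
          exact sum_weight_mul_le hA.inj (by norm_num) w v F
      _ = _ := by ring
  exact le_of_mul_le_mul_left hsum hpos

/-- `1 - A / b` is a contraction, in bilinear form. -/
theorem inner_sub_inner_div_le (hA : IsDecayingForm e K κ a b A) (hb : 0 < b) (hab : a ≤ b)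
    (z y : HpI ι p) :
    inner ℝ z y - inner ℝ z (A y) / b ≤ (1 - a / b) * ‖z‖ * ‖y‖ := by
  rcases (norm_nonneg z).eq_or_lt with hz | hz
  · rw [norm_eq_zero.mp hz.symm]; simp
  rcases (norm_nonneg y).eq_or_lt with hy | hy
  · rw [norm_eq_zero.mp hy.symm]; simp
  have hr : 0 ≤ 1 - a / b := by
    rw [sub_nonneg, div_le_one hb]; exact hab
  set z' := ‖y‖ • z with hz'
  set y' := ‖z‖ • y with hy'
  have hupper : inner ℝ (z' + y') (z' + y') - inner ℝ (z' + y') (A (z' + y')) / b ≤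
      (1 - a / b) * ‖z' + y'‖ ^ 2 := by
    have h : a / b * ‖z' + y'‖ ^ 2 ≤ inner ℝ (z' + y') (A (z' + y')) / b := by
      rw [div_mul_eq_mul_div]
      gcongr
      exact hA.lower _
    rw [real_inner_self_eq_norm_sq]
    linarith
  have hlower : 0 ≤ inner ℝ (z' - y') (z' - y') - inner ℝ (z' - y') (A (z' - y')) / b := by
    rw [real_inner_self_eq_norm_sq, sub_nonneg, div_le_iff₀ hb, mul_comm]
    exact hA.upper _
  have hnorm : ‖z' + y'‖ ^ 2 ≤ (2 * (‖z‖ * ‖y‖)) ^ 2 := by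
    gcongr
    refine (norm_add_le _ _).trans (le_of_eq ?_)
    rw [hz', hy', norm_smul, norm_smul, norm_norm, norm_norm]
    ring
  have hpol : (inner ℝ (z' + y') (z' + y') - inner ℝ (z' + y') (A (z' + y')) / b) -
      (inner ℝ (z' - y') (z' - y') - inner ℝ (z' - y') (A (z' - y')) / b) =
      4 * ((‖z‖ * ‖y‖) * (inner ℝ z y - inner ℝ z (A y) / b)) := by
    have hs : inner ℝ y (A z) = inner ℝ z (A y) := by rw [← hA.symm, real_inner_comm]
    simp only [hz', hy', map_add, map_sub, map_smul, inner_add_left, inner_add_right,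
      inner_sub_left, inner_sub_right, real_inner_smul_left, real_inner_smul_right, hs,
      real_inner_comm z y]
    ring
  have hfin : (‖z‖ * ‖y‖) * (inner ℝ z y - inner ℝ z (A y) / b) ≤
      (‖z‖ * ‖y‖) * ((1 - a / b) * ‖z‖ * ‖y‖) := by
    have h := mul_le_mul_of_nonneg_left hnorm hr
    nlinarith
  exact le_of_mul_le_mul_left hfin (mul_pos hz hy)

end IsDecayingForm

theorem exists_bound_of_recursive_decay {c r σ : ℝ} (hr0 : 0 ≤ r) (hr : r < 1) (hσ : 0 < σ) :
    ∃ B : ℝ, 1 ≤ B ∧ ∀ (f : ℝ → ℝ) (X : ℝ), 0 ≤ X → (∀ N, f N ≤ X) →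
      (∀ M N, 0 < M → M < N → f N ≤ c * X * (N - M) ^ (-σ) + r * f M) →
      ∀ N, 0 < N → f N ≤ B * X * N ^ (-σ) := by
  have hmid0 : 0 < (1 + r) / 2 := by linarith
  set θ : ℝ := ((1 + r) / 2) ^ (1 / σ) with hθ
  have hθ0 : 0 < θ := Real.rpow_pos_of_pos hmid0 _
  have hθ1 : θ < 1 := Real.rpow_lt_one hmid0.le (by linarith) (by positivity)
  have hθσ : θ ^ (-σ) = ((1 + r) / 2)⁻¹ := by
    rw [hθ, ← Real.rpow_mul hmid0.le, show 1 / σ * -σ = -1 by field_simp, Real.rpow_neg_one]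
  set q : ℝ := r * ((1 + r) / 2)⁻¹ with hq
  have hq1 : q < 1 := by
    rw [hq, ← div_eq_mul_inv, div_lt_one hmid0]; linarith
  set B : ℝ := max 1 (c * (1 - θ) ^ (-σ) / (1 - q)) with hB
  have hB1 : 1 ≤ B := le_max_left _ _
  have hBq : c * (1 - θ) ^ (-σ) + q * B ≤ B := by
    have h := (div_le_iff₀ (by linarith : 0 < 1 - q)).mp (le_max_right 1 _ : _ ≤ B)
    linarith
  refine ⟨B, hB1, fun f X hX hf hrec => ?_⟩
  have key : ∀ k : ℕ, ∀ N, 0 < N → θ ^ k * N ≤ 1 → f N ≤ B * X * N ^ (-σ) := by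
    intro k
    induction k with
    | zero =>
      intro N hN hN1
      rw [pow_zero, one_mul] at hN1
      have h1 : 1 ≤ N ^ (-σ) := Real.one_le_rpow_of_pos_of_le_one_of_nonpos hN hN1 (by linarith)
      calc f N ≤ 1 * X * 1 := by simpa using hf N
        _ ≤ B * X * N ^ (-σ) := by gcongr
    | succ k ih =>
      intro N hN hN1
      have hθN : 0 < θ * N := mul_pos hθ0 hN
      have h1 := ih (θ * N) hθN (by rw [← mul_assoc, ← pow_succ]; exact hN1)
      have h2 := hrec (θ * N) N hθN (by nlinarith)
      rw [show N - θ * N = (1 - θ) * N by ring,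
        Real.mul_rpow (by linarith : 0 ≤ 1 - θ) hN.le] at h2
      rw [Real.mul_rpow hθ0.le hN.le, hθσ] at h1
      have hXN : 0 ≤ X * N ^ (-σ) := mul_nonneg hX (Real.rpow_nonneg hN.le _)
      calc f N ≤ c * X * ((1 - θ) ^ (-σ) * N ^ (-σ)) + r * f (θ * N) := h2
        _ ≤ c * X * ((1 - θ) ^ (-σ) * N ^ (-σ)) +
            r * (B * X * (((1 + r) / 2)⁻¹ * N ^ (-σ))) := by gcongr
        _ = (c * (1 - θ) ^ (-σ) + q * B) * (X * N ^ (-σ)) := by rw [hq]; ring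
        _ ≤ B * (X * N ^ (-σ)) := by gcongr
        _ = B * X * N ^ (-σ) := by ring
  intro N hN
  obtain ⟨k, hk⟩ := exists_pow_lt_of_lt_one (inv_pos.mpr hN) hθ1
  refine key k N hN ?_
  calc θ ^ k * N ≤ N⁻¹ * N := by gcongr
    _ = 1 := inv_mul_cancel₀ hN.ne'

namespace IsDecayingForm

variable {ι : Type} [DecidableEq ι] {p : ℕ} {e : ι → ℤ} {K κ a b : ℝ}
  {A : HpI ι p →L[ℝ] HpI ι p}

theorem norm_le_of_apply_eq_single (hA : IsDecayingForm e K κ a b A) (ha : 0 < a)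
    {x : HpI ι p} {τ : ι} {u : EuclideanSpace ℝ (Fin p)} (hx : A x = lp.single 2 τ u) :
    ‖x‖ ≤ a⁻¹ * ‖u‖ := by
  rcases (norm_nonneg x).eq_or_lt with h0 | h0
  · rw [← h0]; positivity
  have h1 := hA.lower x
  have h2 := real_inner_le_norm x (A x)
  rw [hx, norm_single_eq, ← hx] at h2
  have h3 : ‖x‖ * (a * ‖x‖) ≤ ‖x‖ * ‖u‖ := by nlinarith
  rw [inv_mul_eq_div, le_div_iff₀ ha, mul_comm]
  exact le_of_mul_le_mul_left h3 h0

/-- The part of the solution of `A x = δ_τ ⊗ u` at distance at least `N` from `τ` is controlled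
by the part at a smaller distance `M`, with a factor less than one. -/
theorem norm_cutoff_recursion (hA : IsDecayingForm e K κ a b A) (hK : 0 ≤ K)
    (hκ : 3 / 2 ≤ κ) (hb : 0 < b) (hab : a ≤ b) {x : HpI ι p} {τ : ι}
    {u : EuclideanSpace ℝ (Fin p)} (hx : A x = lp.single 2 τ u) {M N : ℝ} (hM : 0 < M)
    (hMN : M < N) :
    ‖cutoff {t | N ≤ |(e t : ℝ) - e τ|} x‖ ≤
      K * guSum (3 / 2) / b * ‖x‖ * (N - M) ^ (-(κ - 3 / 2)) +
        (1 - a / b) * ‖cutoff {t | M ≤ |(e t : ℝ) - e τ|} x‖ := by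
  set E : Set ι := {t | N ≤ |(e t : ℝ) - e τ|} with hE
  set G : Set ι := {t | M ≤ |(e t : ℝ) - e τ|} with hG
  set y := cutoff E x with hy
  have hEG : E ⊆ G := fun t ht => hMN.le.trans ht
  have hyA : inner ℝ y (A x) = 0 := by
    rw [hx]
    refine inner_cutoff_left E x _ fun i hi => lp.single_apply_ne _ _ _ ?_
    rintro rfl
    rw [hE, Set.mem_ofPred_eq, sub_self, abs_zero] at hi
    linarith
  have hy1 : inner ℝ y (cutoff Gᶜ x) = 0 :=
    inner_cutoff_left E x _ fun i hi => cutoff_apply_of_notMem x (by simpa using hEG hi)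
  have hy2 : inner ℝ y (cutoff G x) = ‖y‖ ^ 2 := by
    have h := congrArg (inner ℝ y) (cutoff_add_cutoff_compl G x)
    rw [inner_add_right, hy1, add_zero] at h
    rw [h, hy, inner_cutoff_self]
  have hsplit : inner ℝ y (A (cutoff G x)) = -inner ℝ y (A (cutoff Gᶜ x)) := by
    rw [← cutoff_add_cutoff_compl G x, map_add, inner_add_right] at hyA
    linarith
  have hsep : |inner ℝ y (A (cutoff Gᶜ x))| ≤
      K * guSum (3 / 2) * (N - M) ^ (-(κ - 3 / 2)) * ‖y‖ * ‖cutoff Gᶜ x‖ := by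
    refine hA.abs_inner_le_of_separated hK hκ (sub_pos.mpr hMN) fun t s ht hs => ?_
    have ht' : t ∈ E := by
      by_contra h; exact ht (cutoff_apply_of_notMem x h)
    have hs' : s ∉ G := by
      intro h; exact hs (cutoff_apply_of_notMem x (by simpa using h))
    rw [hE, Set.mem_ofPred_eq] at ht'
    rw [hG, Set.mem_ofPred_eq, not_le] at hs'
    have := abs_sub_le (e t : ℝ) (e s) (e τ)
    linarith
  have hcontr := hA.inner_sub_inner_div_le hb hab y (cutoff G x)
  rw [hy2, hsplit, neg_div, sub_neg_eq_add] at hcontr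
  have hNM : 0 ≤ (N - M) ^ (-(κ - 3 / 2)) := Real.rpow_nonneg (sub_nonneg.mpr hMN.le) _
  have hsep' : -(inner ℝ y (A (cutoff Gᶜ x)) / b) ≤
      K * guSum (3 / 2) / b * ‖x‖ * (N - M) ^ (-(κ - 3 / 2)) * ‖y‖ := by
    rw [← neg_div]
    calc -inner ℝ y (A (cutoff Gᶜ x)) / b
        ≤ K * guSum (3 / 2) * (N - M) ^ (-(κ - 3 / 2)) * ‖y‖ * ‖x‖ / b := by
          gcongr
          refine (neg_le_abs _).trans (hsep.trans ?_)
          gcongr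
          · have := guSum_nonneg (3 / 2); positivity
          · exact norm_cutoff_le _ _
      _ = _ := by ring
  rcases (norm_nonneg y).eq_or_lt with h0 | h0
  · rw [← h0]
    have := guSum_nonneg (3 / 2)
    have hr : 0 ≤ 1 - a / b := by rw [sub_nonneg, div_le_one hb]; exact hab
    positivity
  · refine le_of_mul_le_mul_left ?_ h0
    nlinarith

/-- The diagonal blocks of the inverse are coercive. -/
theorem norm_sq_le_inner_blk_inverse (hA : IsDecayingForm e K κ a b A) (ha : 0 < a) (hb : 0 < b)
    {D : HpI ι p →L[ℝ] HpI ι p} (hAD : A.comp D = ContinuousLinearMap.id ℝ _) (t : ι)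
    (u : EuclideanSpace ℝ (Fin p)) :
    ‖u‖ ^ 2 ≤ b * inner ℝ u (Matrix.toEuclideanLin (blk D t t) u) := by
  have hf : A (D (lp.single 2 t u)) = lp.single 2 t u :=
    congrArg (fun L : HpI ι p →L[ℝ] HpI ι p => L (lp.single 2 t u)) hAD
  rw [← apply_single_eq, ← inner_single_eq, ← norm_single_eq t u]
  set f : HpI ι p := lp.single 2 t u
  set y := D f
  have hpos : 0 ≤ inner ℝ (b • y - f) (A (b • y - f)) + (b * ‖f‖ ^ 2 - inner ℝ f (A f)) :=
    add_nonneg ((hA.lower _).trans' ?_) (sub_nonneg.mpr (hA.upper f))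
  · have hyf : inner ℝ y (A f) = ‖f‖ ^ 2 := by
      rw [← hA.symm, hf, real_inner_self_eq_norm_sq]
    simp only [map_sub, map_smul, inner_sub_left, inner_sub_right, real_inner_smul_left,
      real_inner_smul_right, hf, hyf, real_inner_self_eq_norm_sq, real_inner_comm f y] at hpos
    nlinarith
  · positivity

end IsDecayingForm

/-- The blocks of the inverse of a decaying form decay polynomially off the diagonal, with a
constant that depends only on the constants of the form. -/
theorem exists_specNorm_blk_inverse_le {K κ a b : ℝ} (hK : 0 ≤ K) (hκ : 3 / 2 < κ) (ha : 0 < a)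
    (hab : a ≤ b) :
    ∃ B : ℝ, 0 ≤ B ∧ ∀ {ι : Type} [DecidableEq ι] {p : ℕ} {e : ι → ℤ}
      {A D : HpI ι p →L[ℝ] HpI ι p}, IsDecayingForm e K κ a b A →
      A.comp D = ContinuousLinearMap.id ℝ _ →
      ∀ t τ, specNorm (blk D t τ) ≤ B * gu ((e t : ℝ) - e τ) ^ (-(κ - 3 / 2)) := by
  have hb : 0 < b := ha.trans_le hab
  obtain ⟨B, hB1, hB⟩ := exists_bound_of_recursive_decay (c := K * guSum (3 / 2) / b)
    (r := 1 - a / b) (σ := κ - 3 / 2) (by rw [sub_nonneg, div_le_one hb]; exact hab)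
    (by have := div_pos ha hb; linarith) (by linarith)
  refine ⟨B * a⁻¹, by positivity, fun {ι} _ {p e A D} hA hAD t τ => ?_⟩
  have hgu := gu_rpow_nonneg ((e t : ℝ) - e τ) (-(κ - 3 / 2))
  refine specNorm_le_of_forall (by positivity) fun u => ?_
  rw [← apply_single_eq]
  have hx : A (D (lp.single 2 τ u)) = lp.single 2 τ u :=
    congrArg (fun L : HpI ι p →L[ℝ] HpI ι p => L (lp.single 2 τ u)) hAD
  have hnorm := hA.norm_le_of_apply_eq_single ha hx
  set x := D (lp.single 2 τ u)
  suffices H : ‖x t‖ ≤ B * ‖x‖ * gu ((e t : ℝ) - e τ) ^ (-(κ - 3 / 2)) by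
    calc ‖x t‖ ≤ B * ‖x‖ * gu ((e t : ℝ) - e τ) ^ (-(κ - 3 / 2)) := H
      _ ≤ B * (a⁻¹ * ‖u‖) * gu ((e t : ℝ) - e τ) ^ (-(κ - 3 / 2)) := by gcongr
      _ = _ := by ring
  by_cases htτ : t = τ
  · subst htτ
    have hg : gu ((e t : ℝ) - e t) = 1 := by simp [gu]
    rw [hg, Real.one_rpow, mul_one]
    calc ‖x t‖ ≤ 1 * ‖x‖ := by
          rw [one_mul]; exact lp.norm_apply_le_norm (by simp) x t
      _ ≤ B * ‖x‖ := by gcongr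
  · have h1 : 1 ≤ |(e t : ℝ) - e τ| := by
      exact_mod_cast Int.one_le_abs (sub_ne_zero.mpr (hA.inj.ne htτ))
    have h2 := hB (fun N => ‖cutoff {s | N ≤ |(e s : ℝ) - e τ|} x‖) ‖x‖ (norm_nonneg _)
      (fun N => norm_cutoff_le _ _)
      (fun M N hM hMN => hA.norm_cutoff_recursion hK hκ.le hb hab hx hM hMN)
      |(e t : ℝ) - e τ| (by linarith)
    rw [gu, max_eq_right h1]
    refine le_trans ?_ h2
    rw [← cutoff_apply_of_mem x (E := {s | |(e t : ℝ) - e τ| ≤ |(e s : ℝ) - e τ|}) (i := t) (by simp)]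
    exact lp.norm_apply_le_norm (by simp) _ t

section FiniteSection

variable {ι ι' : Type} [DecidableEq ι] [DecidableEq ι'] [Fintype ι'] {p : ℕ}

/-- The inverse of a compression differs from the compression of the inverse only through paths
that leave the smaller index set. -/
theorem specNorm_blk_inverse_compression_sub_le {f : ι' → ι} (hf : Function.Injective f)
    {A D : HpI ι p →L[ℝ] HpI ι p} {A' D' : HpI ι' p →L[ℝ] HpI ι' p}
    (hblk : ∀ t τ, blk A' t τ = blk A (f t) (f τ))
    (hDA : D.comp A = ContinuousLinearMap.id ℝ _)
    (hAD' : A'.comp D' = ContinuousLinearMap.id ℝ _) (t j : ι') {β : ι' → ℝ}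
    (hβ0 : ∀ i, 0 ≤ β i)
    (hβ : ∀ i, ∀ s : Finset ι, (∀ l ∈ s, l ∉ Set.range f) →
      ∑ l ∈ s, specNorm (blk D (f t) l) * specNorm (blk A l (f i)) ≤ β i) :
    specNorm (blk D' t j - blk D (f t) (f j)) ≤ ∑ i, β i * specNorm (blk D' i j) := by
  classical
  refine specNorm_le_of_forall
    (Finset.sum_nonneg fun i _ => mul_nonneg (hβ0 i) (specNorm_nonneg _)) fun u => ?_
  set y : HpI ι' p := D' (lp.single 2 j u) with hy
  have hAy : A' y = lp.single 2 j u :=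
    congrArg (fun L : HpI ι' p →L[ℝ] HpI ι' p => L (lp.single 2 j u)) hAD'
  set Y : HpI ι p := extendZero p hf y with hY
  have hYsum : Y = ∑ i, lp.single 2 (f i) (y i) := by
    have h := (hasSum_lp_single y).mapL (extendZero p hf).toContinuousLinearMap
    simp only [LinearIsometry.coe_toContinuousLinearMap, extendZero_single] at h
    exact h.unique (hasSum_fintype _)
  set q : HpI ι p := A Y - lp.single 2 (f j) u with hq
  have hq_apply : ∀ l, q l = A Y l - (lp.single 2 (f j) u : HpI ι p) l := fun _ => rfl
  have hq_range : ∀ l ∈ Set.range f, q l = 0 := by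
    rintro _ ⟨i, rfl⟩
    rw [hq_apply, ← extendZero_single hf, hY, compression_apply hf hblk, extendZero_apply, hAy,
      sub_self]
  have hq_compl : ∀ l, l ∉ Set.range f →
      ‖q l‖ ≤ ∑ i, specNorm (blk A l (f i)) * ‖y i‖ := by
    intro l hl
    rw [hq_apply, lp.single_apply_ne _ _ _ (fun h => hl ⟨j, h.symm⟩), sub_zero, hYsum, map_sum,
      lp.coeFn_sum, Finset.sum_apply]
    exact (norm_sum_le _ _).trans (Finset.sum_le_sum fun i _ => norm_apply_single_le A l (f i) _)
  have hDq : D q = Y - D (lp.single 2 (f j) u) := by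
    rw [hq, map_sub]
    congr 1
    exact congrArg (fun L : HpI ι p →L[ℝ] HpI ι p => L Y) hDA
  have hgoal : Matrix.toEuclideanLin (blk D' t j - blk D (f t) (f j)) u = D q (f t) := by
    rw [map_sub, LinearMap.sub_apply, ← apply_single_eq, ← apply_single_eq, hDq, lp.coeFn_sub,
      Pi.sub_apply, hY, extendZero_apply]
  rw [hgoal]
  refine le_of_tendsto' (hasSum_clm_apply D q (f t)).norm fun s => ?_
  calc ‖∑ l ∈ s, D (lp.single 2 l (q l)) (f t)‖
      ≤ ∑ l ∈ s, specNorm (blk D (f t) l) * ‖q l‖ :=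
        (norm_sum_le _ _).trans (Finset.sum_le_sum fun l _ => norm_apply_single_le D (f t) l _)
    _ = ∑ l ∈ s with l ∉ Set.range f, specNorm (blk D (f t) l) * ‖q l‖ := by
        symm
        refine Finset.sum_filter_of_ne fun l _ h hl => h ?_
        rw [hq_range l hl, norm_zero, mul_zero]
    _ ≤ ∑ l ∈ s with l ∉ Set.range f,
          specNorm (blk D (f t) l) * ∑ i, specNorm (blk A l (f i)) * ‖y i‖ := by
        refine Finset.sum_le_sum fun l hl => ?_
        gcongr
        · exact specNorm_nonneg _
        · exact hq_compl l (Finset.mem_filter.mp hl).2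
    _ = ∑ i, (∑ l ∈ s with l ∉ Set.range f,
          specNorm (blk D (f t) l) * specNorm (blk A l (f i))) * ‖y i‖ := by
        simp only [Finset.mul_sum, Finset.sum_mul]
        rw [Finset.sum_comm]
        simp only [mul_assoc]
    _ ≤ ∑ i, β i * (specNorm (blk D' i j) * ‖u‖) := by
        refine Finset.sum_le_sum fun i _ => ?_
        refine mul_le_mul (hβ i _ fun l hl => (Finset.mem_filter.mp hl).2)
          (norm_apply_single_le D' i j u) (norm_nonneg _) (hβ0 i)
    _ = (∑ i, β i * specNorm (blk D' i j)) * ‖u‖ := by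
        simp only [Finset.sum_mul, mul_assoc]

theorem specNorm_normalized_sub_le {M N x y : Matrix (Fin p) (Fin p) ℝ} {b : ℝ} (hb : 0 ≤ b)
    (hM : IsUnit M.det) (hN : IsUnit N.det) (hMb : specNorm M⁻¹ ≤ b) (hNb : specNorm N⁻¹ ≤ b) :
    specNorm (-(M⁻¹ * x) - -(N⁻¹ * y)) ≤
      b * (specNorm (x - y) + specNorm (M - N) * (b * specNorm y)) := by
  have h : -(M⁻¹ * x) - -(N⁻¹ * y) = -(M⁻¹ * ((x - y) - (M - N) * (N⁻¹ * y))) := by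
    rw [mul_sub, mul_sub, sub_mul, mul_sub, ← mul_assoc M⁻¹ M, ← mul_assoc N N⁻¹,
      Matrix.nonsing_inv_mul _ hM, Matrix.mul_nonsing_inv _ hN, one_mul, one_mul]
    abel
  rw [h, specNorm_neg]
  refine (specNorm_mul_le _ _).trans ?_
  gcongr
  · exact specNorm_nonneg _
  refine (specNorm_sub_le _ _).trans ?_
  gcongr
  refine (specNorm_mul_le _ _).trans ?_
  gcongr
  · exact specNorm_nonneg _
  refine (specNorm_mul_le _ _).trans ?_
  gcongr
  exact specNorm_nonneg _

/-- Summed error between the normalized rows of the inverse of a decaying form and of the inverse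
of one of its finite sections, when the section is an upper interval of the index set. -/
theorem sum_specNorm_normalized_sub_le {K κ a b B δ : ℝ} (hK : 0 ≤ K) (hκ : 5 / 2 < κ)
    (ha : 0 < a) (hab : a ≤ b) (hB : 0 ≤ B) {e : ι → ℤ} {f : ι' → ι}
    (hf : Function.Injective f)
    {A D : HpI ι p →L[ℝ] HpI ι p} {A' D' : HpI ι' p →L[ℝ] HpI ι' p}
    (hA : IsDecayingForm e K κ a b A) (hA' : IsDecayingForm (e ∘ f) K κ a b A')
    (hblk : ∀ t τ, blk A' t τ = blk A (f t) (f τ))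
    (hAD : A.comp D = ContinuousLinearMap.id ℝ _) (hDA : D.comp A = ContinuousLinearMap.id ℝ _)
    (hAD' : A'.comp D' = ContinuousLinearMap.id ℝ _)
    (hD : ∀ t τ, specNorm (blk D t τ) ≤ B * gu ((e t : ℝ) - e τ) ^ (-(κ - 3 / 2)))
    (hD' : ∀ t τ, specNorm (blk D' t τ) ≤ B * gu ((e (f t) : ℝ) - e (f τ)) ^ (-(κ - 3 / 2)))
    {m : ℤ} (hm : ∀ l, l ∉ Set.range f → e l ≤ m) (hm' : ∀ i, m ≤ e (f i)) (t : ι')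
    (hδ : 0 < δ) (hδt : δ ≤ (e (f t) : ℝ) - m) (F : Finset ι') :
    ∑ j ∈ F, specNorm (-((blk D' t t)⁻¹ * blk D' t j) -
        -((blk D (f t) (f t))⁻¹ * blk D (f t) (f j))) ≤
      b * (1 + b * (B * guSum (κ - 3 / 2))) *
        (B ^ 2 * K * guSum (3 / 2) * guSum (κ - 3 / 2) ^ 2) * δ ^ (-(κ - 3 / 2)) := by
  have hb : 0 < b := ha.trans_le hab
  set σ : ℝ := κ - 3 / 2 with hσ
  have hσ1 : 1 < σ := by linarith
  set S : ℝ := guSum σ with hS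
  set Z : ℝ := guSum (3 / 2) with hZ
  have hS0 : 0 ≤ S := guSum_nonneg _
  have hZ0 : 0 ≤ Z := guSum_nonneg _
  have hδσ : 0 ≤ δ ^ (-σ) := Real.rpow_nonneg hδ.le _
  have hinj' : Function.Injective fun i => e (f i) := hA.inj.comp hf
  set β : ι' → ℝ := fun i => B * δ ^ (-σ) * (K * Z) * gu ((e (f i) : ℝ) - m) ^ (-σ) with hβdef
  have hβ0 : ∀ i, 0 ≤ β i := fun i =>
    mul_nonneg (by positivity) (gu_rpow_nonneg _ _)
  have hβ : ∀ i, ∀ s : Finset ι, (∀ l ∈ s, l ∉ Set.range f) →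
      ∑ l ∈ s, specNorm (blk D (f t) l) * specNorm (blk A l (f i)) ≤ β i := by
    intro i s hs
    have hterm : ∀ l ∈ s, specNorm (blk D (f t) l) * specNorm (blk A l (f i)) ≤
        B * δ ^ (-σ) * K * gu ((e (f i) : ℝ) - m) ^ (-σ) *
          gu ((e l : ℝ) - e (f i)) ^ (-(3 / 2 : ℝ)) := by
      intro l hl
      have hlm : (e l : ℝ) ≤ m := by exact_mod_cast hm l (hs l hl)
      have him : (m : ℝ) ≤ e (f i) := by exact_mod_cast hm' i
      have h1 : specNorm (blk D (f t) l) ≤ B * δ ^ (-σ) := by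
        refine (hD _ _).trans ?_
        gcongr 1
        refine Real.rpow_le_rpow_of_nonpos hδ ?_ (by linarith)
        exact (by linarith : δ ≤ (e (f t) : ℝ) - e l).trans ((le_abs_self _).trans (abs_le_gu _))
      have h2 : specNorm (blk A l (f i)) ≤ K * (gu ((e (f i) : ℝ) - m) ^ (-σ) *
          gu ((e l : ℝ) - e (f i)) ^ (-(3 / 2 : ℝ))) := by
        refine (hA.decay l (f i) fun h => hs l hl ⟨i, h.symm⟩).trans ?_
        gcongr
        refine gu_rpow_le_mul (by linarith) (gu_pos _) ?_
        rw [gu_sub_comm (e l : ℝ)]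
        refine max_le_max le_rfl ?_
        rw [abs_of_nonneg (by linarith), abs_of_nonneg (by linarith)]
        linarith
      calc _ ≤ B * δ ^ (-σ) * (K * (gu ((e (f i) : ℝ) - m) ^ (-σ) *
            gu ((e l : ℝ) - e (f i)) ^ (-(3 / 2 : ℝ)))) :=
            mul_le_mul h1 h2 (specNorm_nonneg _) (by positivity)
        _ = _ := by ring
    refine (Finset.sum_le_sum hterm).trans ?_
    rw [← Finset.mul_sum]
    have hgu := gu_rpow_nonneg ((e (f i) : ℝ) - m) (-σ)
    calc _ ≤ B * δ ^ (-σ) * K * gu ((e (f i) : ℝ) - m) ^ (-σ) * Z := by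
          gcongr
          exact sum_gu_rpow_le hA.inj (by norm_num) _ s
      _ = β i := by rw [hβdef]; ring
  set η : ℝ := B ^ 2 * K * Z * S ^ 2 * δ ^ (-σ) with hη
  have herr : ∀ G : Finset ι', ∑ j ∈ G, specNorm (blk D' t j - blk D (f t) (f j)) ≤ η := by
    intro G
    calc _ ≤ ∑ j ∈ G, ∑ i, β i * (B * gu ((e (f i) : ℝ) - e (f j)) ^ (-σ)) := by
          refine Finset.sum_le_sum fun j _ =>
            (specNorm_blk_inverse_compression_sub_le hf hblk hDA hAD' t j hβ0 hβ).trans ?_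
          exact Finset.sum_le_sum fun i _ => mul_le_mul_of_nonneg_left (hD' i j) (hβ0 i)
      _ = ∑ i, β i * (B * ∑ j ∈ G, gu ((e (f i) : ℝ) - e (f j)) ^ (-σ)) := by
          rw [Finset.sum_comm]
          simp only [Finset.mul_sum]
      _ ≤ ∑ i, β i * (B * S) := by
          refine Finset.sum_le_sum fun i _ => mul_le_mul_of_nonneg_left ?_ (hβ0 i)
          gcongr
          exact sum_gu_rpow_le' hinj' hσ1 _ G
      _ = B * δ ^ (-σ) * (K * Z) * (B * S) * ∑ i, gu ((e (f i) : ℝ) - m) ^ (-σ) := by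
          rw [Finset.mul_sum]
          exact Finset.sum_congr rfl fun i _ => by rw [hβdef]; ring
      _ ≤ B * δ ^ (-σ) * (K * Z) * (B * S) * S := by
          gcongr
          exact sum_gu_rpow_le hinj' hσ1 m _
      _ = η := by rw [hη]; ring
  have hrow : ∑ j ∈ F, specNorm (blk D (f t) (f j)) ≤ B * S := by
    refine (Finset.sum_le_sum fun j _ => hD (f t) (f j)).trans ?_
    rw [← Finset.mul_sum]
    gcongr
    exact sum_gu_rpow_le' hinj' hσ1 _ F
  have hdiag : specNorm (blk D' t t - blk D (f t) (f t)) ≤ η := by simpa using herr {t}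
  obtain ⟨hu, hinv⟩ := coercive_isUnit_det_and_specNorm_inv_le hb
    (hA.norm_sq_le_inner_blk_inverse ha hb hAD (f t))
  obtain ⟨hu', hinv'⟩ := coercive_isUnit_det_and_specNorm_inv_le hb
    (hA'.norm_sq_le_inner_blk_inverse ha hb hAD' t)
  have hη0 : 0 ≤ η := by positivity
  calc _ ≤ ∑ j ∈ F, b * (specNorm (blk D' t j - blk D (f t) (f j)) +
        η * (b * specNorm (blk D (f t) (f j)))) := by
        refine Finset.sum_le_sum fun j _ =>
          (specNorm_normalized_sub_le hb.le hu' hu hinv' hinv).trans ?_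
        gcongr
        exact mul_nonneg hb.le (specNorm_nonneg _)
    _ = b * (∑ j ∈ F, specNorm (blk D' t j - blk D (f t) (f j)) +
        η * (b * ∑ j ∈ F, specNorm (blk D (f t) (f j)))) := by
        rw [← Finset.mul_sum, Finset.sum_add_distrib, ← Finset.mul_sum, ← Finset.mul_sum]
    _ ≤ b * (η + η * (b * (B * S))) := by
        gcongr
        exact herr F
    _ = _ := by rw [hη]; ring

end FiniteSection

theorem rpow_neg_le_zeta_rpow_s3 {d : ℕ} (hd : 1 ≤ d) {σ : ℝ} (hσ : 0 ≤ σ) :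
    (d : ℝ) ^ (-σ) ≤ zeta (d : ℝ) ^ σ := by
  have hd1 : (1 : ℝ) ≤ d := by exact_mod_cast hd
  have hgu : gu (d : ℝ) = d := by rw [gu, abs_of_nonneg (by linarith), max_eq_right hd1]
  rw [Real.rpow_neg (by linarith), ← Real.inv_rpow (by linarith)]
  refine Real.rpow_le_rpow (by positivity) ?_ hσ
  rw [zeta, hgu, inv_eq_one_div]
  gcongr
  exact le_max_left _ _

/-- Theorem 2.2, bound (2.6): summed Baxter-type inequality. -/
theorem baxter_summed (K κ lamInf lamSup : ℝ)
    (hκ : 5 / 2 < κ) (hInf : 0 < lamInf) (hle : lamInf ≤ lamSup) :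
    ∃ 𝒦 : ℝ, 0 < 𝒦 ∧
      ∀ (p : ℕ), 1 ≤ p → ∀ (C : Hp p →L[ℝ] Hp p), AssumptionA p K κ lamInf lamSup C →
        ∀ (T : ℤ)
          (CT DT : HpI {t : ℤ // t ≤ T} p →L[ℝ] HpI {t : ℤ // t ≤ T} p),
          (∀ t τ : {t : ℤ // t ≤ T}, blk CT t τ = blk C (t : ℤ) (τ : ℤ)) →
          CT.comp DT = ContinuousLinearMap.id ℝ _ →
          DT.comp CT = ContinuousLinearMap.id ℝ _ →
          ∀ (d : ℕ), 1 ≤ d →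
            ∀ (Cd Dd : HpI {t : ℤ // T - (d : ℤ) ≤ t ∧ t ≤ T} p →L[ℝ]
                       HpI {t : ℤ // T - (d : ℤ) ≤ t ∧ t ≤ T} p),
              (∀ t τ : {t : ℤ // T - (d : ℤ) ≤ t ∧ t ≤ T},
                blk Cd t τ = blk C (t : ℤ) (τ : ℤ)) →
              Cd.comp Dd = ContinuousLinearMap.id ℝ _ →
              Dd.comp Cd = ContinuousLinearMap.id ℝ _ →
              ∑ j ∈ (Finset.Icc 1 d).attach,
                  specNorm (PhiFin Dd j.1 (Finset.mem_Icc.mp j.2).2 - PhiInf DT j.1) ≤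
                𝒦 * zeta (d : ℝ) ^ (κ - 3 / 2) := by
  obtain ⟨B, hB0, hB⟩ := exists_specNorm_blk_inverse_le (abs_nonneg K) (by linarith : 3 / 2 < κ)
    hInf hle
  set 𝒦₀ := lamSup * (1 + lamSup * (B * guSum (κ - 3 / 2))) *
    (B ^ 2 * |K| * guSum (3 / 2) * guSum (κ - 3 / 2) ^ 2) with h𝒦₀
  have hSup : 0 < lamSup := hInf.trans_le hle
  have h0 : 0 ≤ 𝒦₀ := by
    have := guSum_nonneg (κ - 3 / 2)
    have := guSum_nonneg (3 / 2)
    positivity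
  refine ⟨𝒦₀ + 1, by linarith, fun p _ C hC T CT DT hCT hCDT hDCT d hd Cd Dd hCd hCDd _ => ?_⟩
  have : Finite {t : ℤ // T - (d : ℤ) ≤ t ∧ t ≤ T} :=
    (Set.finite_Icc (T - (d : ℤ)) T).to_subtype
  have : Fintype {t : ℤ // T - (d : ℤ) ≤ t ∧ t ≤ T} := Fintype.ofFinite _
  let f : {t : ℤ // T - (d : ℤ) ≤ t ∧ t ≤ T} → {t : ℤ // t ≤ T} := fun i => ⟨i.1, i.2.2⟩
  have hf : Function.Injective f := fun i j h => by
    have := congrArg Subtype.val h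
    exact Subtype.ext this
  have hA := hC.isDecayingForm_compression Subtype.val_injective hCT
  have hA' : IsDecayingForm (Subtype.val ∘ f) |K| κ lamInf lamSup Cd :=
    hC.isDecayingForm_compression (Subtype.val_injective.comp hf) hCd
  let idx : {j // j ∈ Finset.Icc 1 d} ↪ {t : ℤ // T - (d : ℤ) ≤ t ∧ t ≤ T} :=
    ⟨fun j => ⟨T - (j.1 : ℤ), by have := (Finset.mem_Icc.mp j.2).2; omega⟩, fun i j h => by
      have := congrArg Subtype.val h
      dsimp only at this
      exact Subtype.ext (by omega)⟩
  have hmain := sum_specNorm_normalized_sub_le (abs_nonneg K) hκ hInf hle hB0 hf hA hA'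
    (fun t τ => (hCd t τ).trans (hCT (f t) (f τ)).symm) hCDT hDCT hCDd (hB hA hCDT)
    (hB hA' hCDd) (m := T - d)
    (fun l hl => by
      by_contra! h
      exact hl ⟨⟨l.1, h.le, l.2⟩, rfl⟩)
    (fun i => i.2.1) ⟨T, by omega, le_rfl⟩ (δ := d) (by exact_mod_cast hd)
    (by push_cast; simp [f]) ((Finset.Icc 1 d).attach.map idx)
  rw [Finset.sum_map, ← h𝒦₀] at hmain
  have hσ : 0 ≤ κ - 3 / 2 := by linarith
  have hz := rpow_neg_le_zeta_rpow_s3 hd hσ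
  have hz0 : 0 ≤ (d : ℝ) ^ (-(κ - 3 / 2)) := by positivity
  calc _ ≤ 𝒦₀ * (d : ℝ) ^ (-(κ - 3 / 2)) := hmain
    _ ≤ (𝒦₀ + 1) * zeta (d : ℝ) ^ (κ - 3 / 2) := by gcongr; linarith
end
end
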